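/- arXiv:2504.16697 — 6 statements merged into one kernel-verified Lean document; each statement's English description precedes it below -/
import Mathlib

section
/- For every integer k ≥ 2, the power series ∑_{n≥0} C(2n,n)^k z^n ∈ ℚ[[z]] is transcendental over ℚ(z); that is, there is no nonzero polynomial P ∈ ℚ[z][Y] with P(f) = 0 in ℚ[[z]] for f = ∑_{n≥0} C(2n,n)^k z^n. -/
/-- A formal power series `f ∈ ℚ[[z]]` is algebraic if it cancels a nonzero
polynomial `P ∈ ℚ[z][Y]`. -/
def PowerSeries.IsAlgebraicSeries (f : PowerSeries ℚ) : Prop :=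
  ∃ P : Polynomial (Polynomial ℚ), P ≠ 0 ∧
    Polynomial.eval₂ Polynomial.coeToPowerSeries.ringHom f P = 0

open PowerSeries in
theorem cb_pow_p (p : ℕ) [hp : Fact p.Prime] (f : PowerSeries (ZMod p)) :
    f ^ p = PowerSeries.expand p hp.out.ne_zero f := by
  have h := MvPowerSeries.map_frobenius_expand (σ := Unit) (R := ZMod p) p hp.out.ne_zero (f := f)
  rw [ZMod.frobenius_zmod, MvPowerSeries.map_id] at h
  exact h.symm

theorem cb_lucas (p : ℕ) [hp : Fact p.Prime] (n : ℕ) :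
    (((2 * n).choose n : ℕ) : ZMod p) =
      ((2 * (n % p)).choose (n % p) : ℕ) * ((2 * (n / p)).choose (n / p) : ℕ) := by
  have hpos := hp.out.pos
  have h1 := Choose.choose_modEq_choose_mod_mul_choose_div_nat (p := p) (n := 2 * n) (k := n)
  have h2 := Choose.choose_modEq_choose_mod_mul_choose_div_nat (p := p)
    (n := 2 * (n % p)) (k := n % p)
  rw [← ZMod.natCast_eq_natCast_iff] at h1 h2
  have hr : n % p < p := Nat.mod_lt _ hpos
  have e1 : n % p % p = n % p := Nat.mod_mod _ _
  have e2 : n % p / p = 0 := Nat.div_eq_of_lt hr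
  have e3 : 2 * (n % p) % p = 2 * n % p := by simp [Nat.mul_mod]
  rw [e1, e2, e3, Nat.choose_zero_right, mul_one] at h2
  rw [h1, h2]
  push_cast
  by_cases hc : 2 * (n % p) < p
  · congr 3
    have : 2 * n = 2 * (n % p) + p * (2 * (n / p)) := by
      conv_lhs => rw [← Nat.mod_add_div n p]
      ring
    rw [this, Nat.add_mul_div_left _ _ hpos, Nat.div_eq_of_lt hc, zero_add]
  · have : 2 * n % p < n % p := by
      rw [← e3, Nat.mod_eq_sub_mod (by omega), Nat.mod_eq_of_lt (by omega)]
      omega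
    rw [Nat.choose_eq_zero_of_lt this]; simp

theorem cb_func (p k : ℕ) [hp : Fact p.Prime] (F : PowerSeries (ZMod p))
    (hF : F = PowerSeries.mk fun n => (((2 * n).choose n ^ k : ℕ) : ZMod p)) :
    F = (PowerSeries.trunc p F : Polynomial (ZMod p)) * F ^ p := by
  have hpos := hp.out.pos
  rw [cb_pow_p]
  ext n
  rw [PowerSeries.coeff_mul, Finset.sum_eq_single (n % p, p * (n / p))]
  · rw [PowerSeries.coeff_coe_trunc_of_lt (Nat.mod_lt _ hpos), PowerSeries.coeff_expand_mul]
    subst hF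
    simp only [PowerSeries.coeff_mk]
    push_cast
    rw [cb_lucas p n, mul_pow]
  · rintro ⟨i, j⟩ hij hne
    rw [Finset.HasAntidiagonal.mem_antidiagonal] at hij
    simp only at hij ⊢
    rw [PowerSeries.coeff_expand, Polynomial.coeff_coe, PowerSeries.coeff_trunc]
    split_ifs with h1 h2
    · exfalso
      obtain ⟨c, rfl⟩ := h2
      apply hne
      rw [← hij, Nat.add_mul_mod_self_left, Nat.mod_eq_of_lt h1, Nat.add_mul_div_left _ _ hpos,
        Nat.div_eq_of_lt h1, zero_add]
    all_goals simp
  · intro h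
    exact absurd (by simp [Nat.mod_add_div]) h

theorem cb_root (p : ℕ) [hp : Fact p.Prime] {B : Type*} [CommRing B] [IsDomain B]
    [Algebra (ZMod p) B] (x y : B) (hy : y ≠ 0) (h : x ^ (p - 1) = y ^ (p - 1)) :
    ∃ t : ZMod p, t ≠ 0 ∧ x = algebraMap (ZMod p) B t * y := by
  have h1 := hp.out.one_lt
  let K := FractionRing B
  let ψ := algebraMap B K
  have ψinj : Function.Injective ψ := IsFractionRing.injective _ _
  have hy' : ψ y ≠ 0 := by
    rw [Ne, map_eq_zero_iff ψ ψinj]; exact hy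
  let θ : ZMod p →+* K := ψ.comp (algebraMap (ZMod p) B)
  have : CharP K p := charP_of_injective_ringHom θ.injective p
  have h2 : (ψ x / ψ y) ^ p = ψ x / ψ y := by
    have : (ψ x / ψ y) ^ (p - 1) = 1 := by
      rw [div_pow, ← map_pow, ← map_pow, h, div_self]
      rw [map_pow]; exact pow_ne_zero _ hy'
    conv_lhs => rw [show p = (p - 1) + 1 by omega]
    rw [pow_succ, this, one_mul]
  rw [← Subfield.mem_bot_iff_pow_eq_self K p, mem_bot_iff_intCast p K] at h2
  obtain ⟨n, hn⟩ := h2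
  have hx : x = algebraMap (ZMod p) B (n : ZMod p) * y := by
    apply ψinj
    rw [map_mul, map_intCast, map_intCast, hn, div_mul_cancel₀ _ hy']
  refine ⟨n, ?_, hx⟩
  intro h0
  rw [h0, map_zero, zero_mul] at hx
  rw [hx, zero_pow (by omega)] at h
  exact pow_ne_zero _ hy h.symm

theorem cb_kummer (p d : ℕ) [hp : Fact p.Prime] (hp2 : p ≠ 2) (g : PowerSeries (ZMod p)) (hg : g ≠ 0)
    (A : Polynomial (ZMod p)) (hA : A.natDegree ≤ p - 1) (hgA : g ^ (p - 1) = A)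
    (Q : Polynomial (Polynomial (ZMod p))) (hQ : Q ≠ 0) (hd : Q.natDegree ≤ d)
    (hQg : Polynomial.aeval g Q = 0) :
    ∃ e, 1 ≤ e ∧ e ≤ d ∧ ∃ c : Polynomial (ZMod p), c.natDegree ≤ e ∧ g ^ e = c := by
  have h1 := hp.out.one_lt
  have alg : ∀ q : Polynomial (ZMod p), algebraMap _ (PowerSeries (ZMod p)) q = q := by
    intro q
    simp [PowerSeries.algebraMap_apply']
  have inj : Function.Injective (algebraMap (Polynomial (ZMod p)) (PowerSeries (ZMod p))) := by
    intro a b h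
    rw [alg, alg] at h
    exact Polynomial.coe_injective _ h
  have : FaithfulSMul (Polynomial (ZMod p)) (PowerSeries (ZMod p)) :=
    (faithfulSMul_iff_algebraMap_injective _ _).2 inj
  have hX0 : Polynomial.aeval g (Polynomial.X ^ (p - 1) - Polynomial.C A) = 0 := by
    simp [hgA, alg]
  have hint : IsIntegral (Polynomial (ZMod p)) g :=
    ⟨Polynomial.X ^ (p - 1) - Polynomial.C A, Polynomial.monic_X_pow_sub_C _ (by omega), hX0⟩
  set m := minpoly (Polynomial (ZMod p)) g with hm
  have hmon : m.Monic := minpoly.monic hint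
  have hdvd : m ∣ Polynomial.X ^ (p - 1) - Polynomial.C A :=
    minpoly.isIntegrallyClosed_dvd hint hX0
  have hdeg : m.natDegree ≤ d :=
    (Polynomial.natDegree_le_of_dvd (minpoly.isIntegrallyClosed_dvd hint hQg) hQ).trans hd
  have hpos : 0 < m.natDegree := minpoly.natDegree_pos hint
  set c := m.coeff 0 with hc
  let L := AlgebraicClosure (FractionRing (PowerSeries (ZMod p)))
  let φ : Polynomial (ZMod p) →+* L :=
    ((algebraMap (FractionRing (PowerSeries (ZMod p))) L).comp
      (algebraMap (PowerSeries (ZMod p)) (FractionRing (PowerSeries (ZMod p))))).comp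
      (algebraMap (Polynomial (ZMod p)) (PowerSeries (ZMod p)))
  have φinj : Function.Injective φ :=
    ((algebraMap (FractionRing (PowerSeries (ZMod p))) L).injective.comp
      (IsFractionRing.injective _ _)).comp inj
  have hspl : (m.map φ).Splits := IsAlgClosed.splits _
  have hprod := hspl.coeff_zero_eq_prod_roots_of_monic (hmon.map φ)
  have hroots : ∀ r ∈ (m.map φ).roots, r ^ (p - 1) = φ A := by
    intro r hr
    have hr' := Polynomial.isRoot_of_mem_roots hr
    have h3 : ((Polynomial.X ^ (p - 1) - Polynomial.C A).map φ).IsRoot r :=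
      hr'.dvd (Polynomial.map_dvd φ hdvd)
    simpa [Polynomial.IsRoot, sub_eq_zero] using h3
  have hcA : c ^ (p - 1) = A ^ m.natDegree := by
    apply φinj
    rw [map_pow, map_pow, hc, ← Polynomial.coeff_map, hprod, mul_pow, ← pow_mul]
    have hev : Even (p - 1) := hp.out.even_sub_one hp2
    rw [(hev.mul_left _).neg_one_pow, one_mul]
    have hcard : Multiset.card (m.map φ).roots = m.natDegree := by
      rw [← hspl.natDegree_eq_card_roots, hmon.natDegree_map]
    have h5 := Multiset.prod_map_pow (m := (m.map φ).roots) (f := fun r => r) (n := p - 1)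
    rw [Multiset.map_id'] at h5
    rw [← h5, Multiset.map_congr rfl hroots, Multiset.map_const', Multiset.prod_replicate, hcard]
  have hcg : ((c : PowerSeries (ZMod p))) ^ (p - 1) = (g ^ m.natDegree) ^ (p - 1) := by
    rw [← pow_mul, mul_comm, pow_mul, hgA, ← Polynomial.coe_pow, hcA, Polynomial.coe_pow]
  obtain ⟨t, ht, hct⟩ := cb_root p _ _ (pow_ne_zero _ hg) hcg
  refine ⟨m.natDegree, hpos, hdeg, Polynomial.C t⁻¹ * c, ?_, ?_⟩
  · refine (Polynomial.natDegree_C_mul_le _ _).trans ?_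
    have h4 := congrArg Polynomial.natDegree hcA
    rw [Polynomial.natDegree_pow, Polynomial.natDegree_pow] at h4
    have : (p - 1) * c.natDegree ≤ (p - 1) * m.natDegree := by
      rw [h4, mul_comm]; gcongr
    exact Nat.le_of_mul_le_mul_left this (by omega)
  · rw [Polynomial.coe_mul, hct, Polynomial.coe_C, ← mul_assoc]
    have : (PowerSeries.C t⁻¹ : PowerSeries (ZMod p)) * algebraMap (ZMod p) _ t = 1 := by
      rw [PowerSeries.algebraMap_apply, ← map_mul]
      simp [ht]
    rw [this, one_mul]

theorem cb_int (k : ℕ) (f g : PowerSeries ℤ)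
    (hf : f = PowerSeries.mk fun n => (((2 * n).choose n ^ k : ℕ) : ℤ)) (hfg : f * g = 1)
    (Q : Polynomial (Polynomial ℤ)) (hQ : Q ≠ 0)
    (hQg : Polynomial.eval₂ Polynomial.coeToPowerSeries.ringHom g Q = 0) :
    ∃ D : ℕ, 1 ≤ D ∧ ∃ S : Polynomial ℤ, g ^ D = S := by
  obtain ⟨i, hi⟩ : ∃ i, Q.coeff i ≠ 0 := by
    by_contra! h
    exact hQ (Polynomial.ext (by simpa using h))
  obtain ⟨j, hj⟩ : ∃ j, (Q.coeff i).coeff j ≠ 0 := by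
    by_contra! h
    exact hi (Polynomial.ext (by simpa using h))
  set N := (Q.coeff i).coeff j with hN
  set d := Q.natDegree with hd
  have key : ∀ p : ℕ, p.Prime → 2 < p → N.natAbs < p → ∀ n, d.factorial < n →
      (p : ℤ) ∣ PowerSeries.coeff n (g ^ d.factorial) := by
    intro p hp hp2 hpN n hn
    have : Fact p.Prime := ⟨hp⟩
    let φ := Int.castRingHom (ZMod p)
    let Qp := Q.map (Polynomial.mapRingHom φ)
    let F := PowerSeries.map φ f
    let G := PowerSeries.map φ g
    have hFG : F * G = 1 := by
      rw [← map_mul, hfg, map_one]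
    have hQp : Qp ≠ 0 := by
      intro h
      have h1 : (Qp.coeff i).coeff j = 0 := by rw [h]; simp
      have h2 : ((N : ℤ) : ZMod p) = 0 := by
        simpa [Qp, φ, hN] using h1
      rw [ZMod.intCast_zmod_eq_zero_iff_dvd] at h2
      have := Int.natAbs_dvd_natAbs.2 h2
      have := Nat.le_of_dvd (Int.natAbs_pos.2 hj) this
      simp at this
      omega
    have hQpG : Polynomial.aeval G Qp = 0 := by
      have h1 := congrArg (PowerSeries.map φ) hQg
      rw [map_zero, Polynomial.hom_eval₂] at h1
      rw [Polynomial.aeval_def, Polynomial.eval₂_map, ← h1]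
      congr 1
      refine RingHom.ext fun q => ?_
      ext n
      simp [PowerSeries.algebraMap_apply']
    have hF := cb_func p k F (by
      ext n
      simp [F, hf, φ])
    have hGne : G ≠ 0 := right_ne_zero_of_mul_eq_one hFG
    have hGA : G ^ (p - 1) = (PowerSeries.trunc p F : Polynomial (ZMod p)) := by
      have e : p = (p - 1) + 1 := by omega
      have h1 : F ^ p * G ^ p = 1 := by rw [← mul_pow, hFG, one_pow]
      calc G ^ (p - 1) = (F * G) * G ^ (p - 1) := by rw [hFG, one_mul]
        _ = F * G ^ p := by
          rw [mul_assoc, ← pow_succ', ← e]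
        _ = ((PowerSeries.trunc p F : Polynomial (ZMod p)) * F ^ p) * G ^ p := by rw [← hF]
        _ = _ := by rw [mul_assoc, h1, mul_one]
    have hdegA : (PowerSeries.trunc p F).natDegree ≤ p - 1 := by
      have e : p = (p - 1) + 1 := by omega
      have := PowerSeries.natDegree_trunc_lt F (p - 1)
      rw [← e] at this
      omega
    obtain ⟨e, he1, hed, c, hc, hgc⟩ := cb_kummer p d (by omega) G hGne _ hdegA hGA Qp hQp
      (Polynomial.natDegree_map_le) hQpG
    obtain ⟨r, hr⟩ := Nat.dvd_factorial he1 hed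
    have h3 : G ^ d.factorial = ((c ^ r : Polynomial (ZMod p)) : PowerSeries (ZMod p)) := by
      rw [hr, pow_mul, hgc, Polynomial.coe_pow]
    have h4 : PowerSeries.coeff n (G ^ d.factorial) = 0 := by
      rw [h3, Polynomial.coeff_coe]
      apply Polynomial.coeff_eq_zero_of_natDegree_lt
      refine lt_of_le_of_lt ?_ hn
      rw [Polynomial.natDegree_pow, hr, mul_comm]
      gcongr
    rw [← ZMod.intCast_zmod_eq_zero_iff_dvd, ← h4, ← map_pow, PowerSeries.coeff_map]
    rfl
  refine ⟨d.factorial, d.factorial_pos, PowerSeries.trunc (d.factorial + 1) (g ^ d.factorial), ?_⟩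
  ext n
  rw [Polynomial.coeff_coe, PowerSeries.coeff_trunc]
  split_ifs with h
  · rfl
  · set a := PowerSeries.coeff n (g ^ d.factorial) with ha
    by_contra hne
    obtain ⟨p, hp, hpp⟩ := Nat.exists_infinite_primes (3 + N.natAbs + a.natAbs)
    have h1 := key p hpp (by omega) (by omega) n (by omega)
    have h2 := Nat.le_of_dvd (Int.natAbs_pos.2 hne) (Int.natAbs_dvd_natAbs.2 h1)
    simp at h2
    omega

theorem cb_ratio (n j : ℕ) (hj : j ≤ n) :
    ((n - j).centralBinom : ℚ) * ∏ i ∈ Finset.range j, (4 * ((n : ℚ) - (i + 1 / 2))) =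
      n.centralBinom * ∏ i ∈ Finset.range j, ((n : ℚ) - i) := by
  induction j with
  | zero => simp
  | succ j ih =>
    have ih := ih (by omega)
    rw [Finset.prod_range_succ, Finset.prod_range_succ, ← mul_assoc (n.centralBinom : ℚ), ← ih]
    have h := Nat.succ_mul_centralBinom_succ (n - (j + 1))
    rw [show n - (j + 1) + 1 = n - j by omega] at h
    have h' : ((n - j : ℕ) : ℚ) * (n - j).centralBinom =
        2 * (2 * (n - (j + 1) : ℕ) + 1) * (n - (j + 1)).centralBinom := by exact_mod_cast h
    rw [Nat.cast_sub (by omega), Nat.cast_sub hj] at h'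
    push_cast at h'
    linear_combination (-∏ i ∈ Finset.range j, (4 * ((n : ℚ) - (i + 1 / 2)))) * h'

theorem cb_ode (D : ℕ) (hD : 1 ≤ D) (f : PowerSeries ℚ) (S : Polynomial ℚ) (h : f ^ D * S = 1)
    (n : ℕ) (hn : S.natDegree ≤ n) :
    ∑ j ∈ Finset.range (S.natDegree + 1),
      S.coeff j * (D * ((n : ℚ) - j) + j) * PowerSeries.coeff (n - j) f = 0 := by
  have hf0 : f ≠ 0 := by
    rintro rfl
    rw [zero_pow (by omega), zero_mul] at h
    exact zero_ne_one h
  have h1 := congrArg (PowerSeries.derivative ℚ) h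
  rw [Derivation.leibniz, PowerSeries.derivative_pow, PowerSeries.derivative_one,
    smul_eq_mul, smul_eq_mul] at h1
  have h2 : (D : PowerSeries ℚ) * (PowerSeries.derivative ℚ f * S)
      + f * PowerSeries.derivative ℚ (S : PowerSeries ℚ) = 0 := by
    have h3 : f ^ (D - 1) * ((D : PowerSeries ℚ) * (PowerSeries.derivative ℚ f * S)
      + f * PowerSeries.derivative ℚ (S : PowerSeries ℚ)) = 0 := by
      rw [← h1]
      obtain ⟨E, rfl⟩ : ∃ E, D = E + 1 := ⟨D - 1, by omega⟩
      simp only [Nat.add_sub_cancel]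
      ring
    exact (mul_eq_zero.1 h3).resolve_left (pow_ne_zero _ hf0)
  have cX : ∀ (u : PowerSeries ℚ) (n : ℕ),
      PowerSeries.coeff n (PowerSeries.X * PowerSeries.derivative ℚ u) =
        n * PowerSeries.coeff n u := by
    intro u n
    cases n with
    | zero => simp
    | succ n => rw [PowerSeries.coeff_succ_X_mul, PowerSeries.coeff_derivative]; push_cast; ring
  have h4 : (S : PowerSeries ℚ) * (PowerSeries.C (D : ℚ) * (PowerSeries.X * PowerSeries.derivative ℚ f))
      + (PowerSeries.X * PowerSeries.derivative ℚ (S : PowerSeries ℚ)) * f = 0 := by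
    rw [map_natCast]
    linear_combination PowerSeries.X * h2
  have h5 := congrArg (PowerSeries.coeff n) h4
  rw [map_add, PowerSeries.coeff_mul, PowerSeries.coeff_mul, ← Finset.sum_add_distrib, map_zero] at h5
  rw [← h5]
  rw [Finset.Nat.sum_antidiagonal_eq_sum_range_succ_mk]
  rw [Finset.sum_subset (Finset.range_mono (show S.natDegree + 1 ≤ n.succ by omega))]
  · apply Finset.sum_congr rfl
    intro j hj
    have : j ≤ n := by simp at hj; omega
    simp only [PowerSeries.coeff_C_mul, cX, Polynomial.coeff_coe]
    rw [Nat.cast_sub this]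
    ring
  · intro j _ hj
    rw [Polynomial.coeff_eq_zero_of_natDegree_lt (by simp at hj; omega)]
    simp

theorem cb_final (k : ℕ) (hk : 2 ≤ k) (D : ℕ) (hD : 1 ≤ D) (f : PowerSeries ℚ)
    (hf : ∀ n, PowerSeries.coeff n f = (n.centralBinom : ℚ) ^ k) (S : Polynomial ℚ)
    (h : f ^ D * S = 1) : False := by
  have hS : S ≠ 0 := by
    rintro rfl
    simp at h
  have hlead : S.coeff S.natDegree ≠ 0 := by simpa using hS
  have hode := cb_ode D hD f S h
  set m := S.natDegree with hm
  have hD0 : (D : ℚ) ≠ 0 := by positivity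
  rcases Nat.eq_zero_or_pos m with h0 | hpos
  · have := hode 1 (by omega)
    rw [h0] at this hlead
    have hc : (Nat.centralBinom 1 : ℚ) ≠ 0 := by
      exact_mod_cast Nat.centralBinom_ne_zero 1
    simp [hf, hlead, hD0, hc] at this
  let α : ℚ := ((m - 1 : ℕ) : ℚ) + 1 / 2
  let W : ℕ → Polynomial ℚ := fun i =>
    (Polynomial.C 4 * (Polynomial.X - Polynomial.C ((i : ℚ) + 1 / 2))) ^ k
  let V : ℕ → Polynomial ℚ := fun i => (Polynomial.X - Polynomial.C (i : ℚ)) ^ k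
  let L : ℕ → Polynomial ℚ := fun j => Polynomial.C (S.coeff j) *
    (Polynomial.C (D : ℚ) * (Polynomial.X - Polynomial.C (j : ℚ)) + Polynomial.C (j : ℚ))
  let T : Polynomial ℚ := ∑ j ∈ Finset.range (m + 1),
    L j * (∏ i ∈ Finset.range j, V i) * ∏ i ∈ Finset.Ico j m, W i
  have hT : T = 0 := by
    apply Polynomial.eq_zero_of_infinite_isRoot
    apply Set.Infinite.mono (s := (fun n : ℕ => (n : ℚ)) '' Set.Ici m)
    · rintro _ ⟨n, hn, rfl⟩
      have hn : m ≤ n := hn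
      have hc : ((n.centralBinom : ℚ)) ^ k ≠ 0 := by
        have := n.centralBinom_pos
        positivity
      have h1 := hode n hn
      show T.eval (n : ℚ) = 0
      apply mul_left_cancel₀ hc
      rw [mul_zero, ← zero_mul (∏ i ∈ Finset.range m, (W i).eval (n : ℚ)), ← h1, Finset.sum_mul,
        Polynomial.eval_finsetSum, Finset.mul_sum]
      apply Finset.sum_congr rfl
      intro j hj
      have hjm : j ≤ m := by simp at hj; omega
      have hr := congrArg (· ^ k) (cb_ratio n j (hjm.trans hn))
      simp only [mul_pow, ← Finset.prod_pow] at hr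
      rw [← Finset.prod_range_mul_prod_Ico _ hjm, hf]
      simp only [L, V, W, Polynomial.eval_mul, Polynomial.eval_prod, Polynomial.eval_pow,
        Polynomial.eval_sub, Polynomial.eval_add, Polynomial.eval_C, Polynomial.eval_X, mul_pow]
      linear_combination (-(S.coeff j * (D * ((n : ℚ) - j) + j) *
        ∏ i ∈ Finset.Ico j m, (4 ^ k * ((n : ℚ) - (i + 1 / 2)) ^ k))) * hr
    · exact (Set.Ici_infinite m).image Nat.cast_injective.injOn
  have hdvd1 : (Polynomial.X - Polynomial.C α) ^ 2 ∣ ∑ j ∈ Finset.range m,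
      L j * (∏ i ∈ Finset.range j, V i) * ∏ i ∈ Finset.Ico j m, W i := by
    apply Finset.dvd_sum
    intro j hj
    have hjm : j < m := Finset.mem_range.1 hj
    apply Dvd.dvd.mul_left
    refine dvd_trans ?_ (Finset.dvd_prod_of_mem W (a := m - 1) (Finset.mem_Ico.2 ⟨by omega, by omega⟩))
    simp only [W, mul_pow]
    exact Dvd.dvd.mul_left (pow_dvd_pow _ hk) _
  have hdvd2 : (Polynomial.X - Polynomial.C α) ^ 2 ∣ L m * ∏ i ∈ Finset.range m, V i := by
    have h2 : T = _ := Finset.sum_range_succ _ _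
    rw [hT] at h2
    simp only [Finset.Ico_self, Finset.prod_empty, mul_one] at h2
    exact (dvd_add_right hdvd1).1 (h2 ▸ dvd_zero _)
  have hcop : IsCoprime ((Polynomial.X - Polynomial.C α) ^ 2) (∏ i ∈ Finset.range m, V i) := by
    apply IsCoprime.pow_left
    apply IsCoprime.prod_right
    intro i _
    apply IsCoprime.pow_right
    apply Polynomial.isCoprime_X_sub_C_of_isUnit_sub
    rw [isUnit_iff_ne_zero, sub_ne_zero]
    intro hh
    have : (2 * (m - 1) + 1 : ℕ) = 2 * i := by
      have : ((2 * (m - 1) + 1 : ℕ) : ℚ) = (2 * i : ℕ) := by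
        push_cast
        simp only [α] at hh
        linarith
      exact_mod_cast this
    omega
  have hdvd3 := hcop.dvd_of_dvd_mul_right hdvd2
  have hL : L m ≠ 0 := by
    intro h0
    have := congrArg (Polynomial.eval (m : ℚ)) h0
    simp [L, hlead] at this
    omega
  have h6 := Polynomial.natDegree_le_of_dvd hdvd3 hL
  have h7 : (L m).natDegree ≤ 1 := by
    simp only [L]
    compute_degree
  rw [Polynomial.natDegree_pow, Polynomial.natDegree_X_sub_C] at h6
  omega

attribute [local instance] Polynomial.algebra Polynomial.isLocalization in
theorem cb_clear (f : PowerSeries ℤ) (P : Polynomial (Polynomial ℚ)) (hP : P ≠ 0)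
    (h : Polynomial.eval₂ Polynomial.coeToPowerSeries.ringHom
      (PowerSeries.map (Int.castRingHom ℚ) f) P = 0) :
    ∃ Q : Polynomial (Polynomial ℤ), Q ≠ 0 ∧
      Polynomial.eval₂ Polynomial.coeToPowerSeries.ringHom f Q = 0 := by
  let M := (nonZeroDivisors ℤ).map (Polynomial.C : ℤ →+* Polynomial ℤ)
  have hM : M ≤ nonZeroDivisors (Polynomial ℤ) := by
    rintro _ ⟨a, ha, rfl⟩
    apply mem_nonZeroDivisors_of_ne_zero
    have := nonZeroDivisors.ne_zero ha
    simpa using this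
  have : IsLocalization M (Polynomial ℚ) := Polynomial.isLocalization _ _
  refine ⟨IsLocalization.integerNormalization M P, ?_, ?_⟩
  · rw [Ne, IsLocalization.integerNormalization_eq_zero_iff hM]
    exact hP
  · have h1 := IsLocalization.integerNormalization_eval₂_eq_zero M _ P h
    have hinj : Function.Injective (PowerSeries.map (Int.castRingHom ℚ)) :=
      PowerSeries.map_injective _ Int.cast_injective
    apply hinj
    rw [map_zero, Polynomial.hom_eval₂, ← h1]
    congr 1
    refine RingHom.ext fun q => ?_
    ext n
    simp [Polynomial.algebraMap_def]

/-- For `k ≥ 2`, the power series `∑_n C(2n,n)^k z^n` is transcendental. -/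
theorem central_binomial_power_transcendental (k : ℕ) (hk : 2 ≤ k) :
    ¬ PowerSeries.IsAlgebraicSeries (PowerSeries.mk fun n =>
      ((((2 * n).choose n) ^ k : ℕ) : ℚ)) := by
  rintro ⟨P, hP, hPf⟩
  let f : PowerSeries ℤ := PowerSeries.mk fun n => (((2 * n).choose n ^ k : ℕ) : ℤ)
  have hmap : PowerSeries.map (Int.castRingHom ℚ) f =
      PowerSeries.mk fun n => ((((2 * n).choose n) ^ k : ℕ) : ℚ) := by
    ext n
    simp [f]
  rw [← hmap] at hPf
  obtain ⟨Q, hQ, hQf⟩ := cb_clear f P hP hPf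
  have hfg : f * PowerSeries.invOfUnit f 1 = 1 := by
    apply PowerSeries.mul_invOfUnit
    simp [f]
  let inv : Invertible f := ⟨PowerSeries.invOfUnit f 1, by rw [mul_comm]; exact hfg, hfg⟩
  have hQg := (Polynomial.eval₂_reverse_eq_zero_iff Polynomial.coeToPowerSeries.ringHom f Q).2 hQf
  obtain ⟨D, hD, S, hS⟩ := cb_int k f (⅟f) rfl (mul_invOf_self f) Q.reverse
    (by rwa [Ne, Polynomial.reverse_eq_zero]) hQg
  refine cb_final k hk D hD (PowerSeries.map (Int.castRingHom ℚ) f) ?_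
    (S.map (Int.castRingHom ℚ)) ?_
  · intro n
    simp [f, Nat.centralBinom]
  · rw [Polynomial.polynomial_map_coe, ← hS, ← map_pow, ← map_mul, ← mul_pow, mul_invOf_self]
    simp
end

section
/- For all natural numbers j and n, the coefficient of y^n in the polynomial ((1+y)·(y + (1+y)^j))^n ∈ ℤ[y] equals ∑_{k=0}^{n} C(n,k) · C(n+jk,k). -/
/-- The coefficient of `y^n` in `((1+y)(y+(1+y)^j))^n` equals
`∑_{k=0}^n C(n,k) C(n+jk,k)`. -/
theorem coeff_of_kernel_power (j n : ℕ) :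
    ((((1 + Polynomial.X) * (Polynomial.X + (1 + Polynomial.X) ^ j)) ^ n :
        Polynomial ℤ).coeff n) =
      ∑ k ∈ Finset.range (n + 1), (n.choose k : ℤ) * ((n + j * k).choose k : ℤ) := by
  rw [mul_pow, add_comm Polynomial.X ((1 + Polynomial.X) ^ j), add_pow ((1 + Polynomial.X) ^ j), Finset.mul_sum,
    Polynomial.finset_sum_coeff]
  refine Finset.sum_congr rfl fun k hk => ?_
  have hk' : k ≤ n := Nat.lt_succ_iff.mp (Finset.mem_range.mp hk)
  have h : ((1 + Polynomial.X) ^ n * (((1 + Polynomial.X) ^ j) ^ k * Polynomial.X ^ (n - k) *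
      (n.choose k : Polynomial ℤ)) : Polynomial ℤ)
      = Polynomial.C (n.choose k : ℤ) *
        ((1 + Polynomial.X) ^ (n + j * k) * Polynomial.X ^ (n - k)) := by
    rw [pow_add, pow_mul]
    simp only [Polynomial.C_eq_natCast, map_natCast]
    ring
  rw [h, Polynomial.coeff_C_mul, Polynomial.coeff_mul_X_pow', if_pos (Nat.sub_le n k),
    Nat.sub_sub_self hk', Polynomial.coeff_one_add_X_pow]
end

section
/- For every integer j ≥ 1, the power series f = ∑_{n≥0} ( ∑_{k=0}^{n} C(n,k) · C(n+jk,k) ) z^n ∈ ℚ[[z]] is algebraic over ℚ(z); that is, there exists a nonzero polynomial P ∈ ℚ[z][Y] with P(f) = 0 in ℚ[[z]]. -/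
open PowerSeries in
/-- The functional `T(H) = ∑ z^n [x^n] (H φ^n)`. -/
noncomputable def lagT (φ : PowerSeries ℚ) (H : PowerSeries (PowerSeries ℚ)) : PowerSeries ℚ :=
  PowerSeries.mk fun N => ∑ p ∈ Finset.HasAntidiagonal.antidiagonal N,
    coeff p.1 (coeff p.2 (H * (PowerSeries.map (C (R := ℚ)) φ) ^ p.2))

open PowerSeries

theorem lagT_add (φ : PowerSeries ℚ) (H K) : lagT φ (H + K) = lagT φ H + lagT φ K := by
  ext N
  simp [lagT, add_mul, Finset.sum_add_distrib]

theorem lagT_C_mul (φ : PowerSeries ℚ) (r : PowerSeries ℚ) (H) :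
    lagT φ (C r * H) = r * lagT φ H := by
  ext N
  rw [PowerSeries.coeff_mul]
  simp only [lagT, coeff_mk, mul_assoc, coeff_C_mul]
  simp only [PowerSeries.coeff_mul _ r, Finset.mul_sum, Finset.sum_sigma']
  refine Finset.sum_bij' (fun x _ => ⟨(x.2.1, x.2.2 + x.1.2), (x.2.2, x.1.2)⟩)
    (fun x _ => ⟨(x.1.1 + x.2.1, x.2.2), (x.1.1, x.2.1)⟩) ?_ ?_ ?_ ?_ ?_
  · rintro ⟨⟨a, b⟩, ⟨c, d⟩⟩ h
    simp at h ⊢; omega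
  · rintro ⟨⟨a, b⟩, ⟨c, d⟩⟩ h
    simp at h ⊢; omega
  · rintro ⟨⟨a, b⟩, ⟨c, d⟩⟩ h
    simp at h ⊢; omega
  · rintro ⟨⟨a, b⟩, ⟨c, d⟩⟩ h
    simp at h ⊢; omega
  · rintro ⟨⟨a, b⟩, ⟨c, d⟩⟩ h
    rfl

theorem lagT_X_mul (φ : PowerSeries ℚ) (H) :
    lagT φ (X * H) = X * lagT φ (PowerSeries.map (C (R := ℚ)) φ * H) := by
  ext N
  cases N with
  | zero => simp [lagT]
  | succ m =>
    rw [coeff_succ_X_mul]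
    simp only [lagT, coeff_mk]
    rw [Finset.Nat.sum_antidiagonal_succ']
    simp only [mul_assoc, coeff_succ_X_mul, coeff_zero_X_mul, map_zero]
    first | rw [add_zero] | rw [zero_add]
    refine Finset.sum_congr rfl fun p _ => ?_
    rw [pow_succ']
    congr 2
    ring

theorem lagT_map (φ h : PowerSeries ℚ) :
    lagT φ (PowerSeries.map (C (R := ℚ)) h) = PowerSeries.mk fun n => coeff n (h * φ ^ n) := by
  ext N
  simp only [lagT, coeff_mk, ← map_pow, ← map_mul, coeff_map, coeff_C]
  rw [Finset.sum_eq_single (0, N)]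
  · simp
  · rintro ⟨a, b⟩ h1 h2
    have : a ≠ 0 := by
      rintro rfl
      simp at h1
      simp [h1] at h2
    simp [this]
  · simp

theorem lagT_norm (φ : PowerSeries ℚ) (h0 : constantCoeff φ = 1) :
    lagT φ (PowerSeries.map (C (R := ℚ)) (φ⁻¹ * (φ - X * derivative ℚ φ))) = 1 := by
  have hu : φ⁻¹ * φ = 1 := PowerSeries.inv_mul_cancel φ (by simp [h0])
  rw [lagT_map]
  ext N
  rw [coeff_mk]
  cases N with
  | zero => simp [h0]
  | succ m =>
    have e : φ⁻¹ * (φ - X * derivative ℚ φ) * φ ^ (m + 1) =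
        φ ^ (m + 1) - X * (φ ^ m * derivative ℚ φ) := by
      rw [pow_succ]
      linear_combination (φ - X * derivative ℚ φ) * φ ^ m * hu
    rw [e, map_sub, coeff_succ_X_mul]
    have h1 : coeff m (derivative ℚ (φ ^ (m + 1))) = coeff (m + 1) (φ ^ (m + 1)) * (m + 1) :=
      coeff_derivative _ _
    rw [Derivation.leibniz_pow] at h1
    simp only [Nat.add_sub_cancel, smul_eq_mul, nsmul_eq_mul] at h1
    have h2 : ((m + 1 : ℕ) : PowerSeries ℚ) = C ((m : ℚ) + 1) := by simp
    rw [h2, coeff_C_mul] at h1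
    have h3 : (m : ℚ) + 1 ≠ 0 := by positivity
    have : coeff m (φ ^ m * derivative ℚ φ) = coeff (m + 1) (φ ^ (m + 1)) :=
      mul_left_cancel₀ h3 (by rw [h1]; ring)
    rw [this]
    simp [coeff_one]

theorem exists_root (φ : PowerSeries ℚ) : ∃ (w : PowerSeries ℚ),
    ∀ K, lagT φ (X * K) = w * lagT φ K := by
  set Φ := PowerSeries.map (C (R := ℚ)) φ with hΦ
  set g : PowerSeries (PowerSeries ℚ) := X - C X * Φ with hg
  let I : Ideal (PowerSeries ℚ) := Ideal.span {X}
  have hzero : ∀ K, lagT φ (g * K) = 0 := by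
    intro K
    have : X * K = g * K + C X * (Φ * K) := by rw [hg]; ring
    have h2 := congrArg (lagT φ) this
    rw [lagT_add, lagT_C_mul, lagT_X_mul] at h2
    rw [← hΦ] at h2
    exact right_eq_add.1 h2
  have hI : I ≠ ⊤ := by
    rw [Ne, Ideal.span_singleton_eq_top]
    rw [PowerSeries.isUnit_iff_constantCoeff]
    simp
  have : Nontrivial (PowerSeries ℚ ⧸ I) := Ideal.Quotient.nontrivial_iff.2 hI
  have hmap : g.map (Ideal.Quotient.mk I) = X := by
    have : Ideal.Quotient.mk I X = 0 :=
      Ideal.Quotient.eq_zero_iff_mem.2 (Ideal.mem_span_singleton_self _)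
    simp [hg, this]
  have hdiv : g.IsWeierstrassDivisorAt I := by
    rw [IsWeierstrassDivisorAt, hmap, order_X]
    rw [PowerSeries.isUnit_iff_constantCoeff]
    simp [hg]
  have : IsAdicComplete I (PowerSeries ℚ) := by infer_instance
  obtain ⟨hd, he⟩ := hdiv.isWeierstrassDivisionAt_div_mod X
  rw [hmap, order_X] at hd
  generalize hdiv.div X = q at *
  generalize hdiv.mod X = r at *
  have hr : r = Polynomial.C (r.coeff 0) := by
    apply Polynomial.eq_C_of_degree_le_zero
    exact Order.le_of_lt_succ hd
  refine ⟨r.coeff 0, fun K => ?_⟩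
  rw [hr, Polynomial.coe_C] at he
  conv_lhs => rw [he, add_mul, mul_assoc, lagT_add, hzero, zero_add, lagT_C_mul]

theorem lagT_poly (φ : PowerSeries ℚ) (w : PowerSeries ℚ)
    (hw : ∀ K, lagT φ (X * K) = w * lagT φ K) (p : Polynomial ℚ) (K) :
    lagT φ (PowerSeries.map (C (R := ℚ)) (p : PowerSeries ℚ) * K) =
      Polynomial.aeval w p * lagT φ K := by
  induction p using Polynomial.induction_on generalizing K with
  | C a =>
    rw [Polynomial.coe_C, map_C, lagT_C_mul, Polynomial.aeval_C]
    rfl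
  | add p q hp hq => simp [add_mul, lagT_add, hp, hq]
  | monomial n a ih =>
    have := ih (X * K)
    rw [hw] at this
    simp only [Polynomial.coe_mul, Polynomial.coe_pow, Polynomial.coe_X, map_mul, map_pow, map_X,
      pow_succ, Polynomial.aeval_X] at this ⊢
    rw [← mul_assoc] at this
    rw [← mul_assoc, this]
    ring

theorem lag_algebraic (p : Polynomial ℚ) (h0 : p.coeff 0 = 1) :
    IsAlgebraic (Polynomial ℚ) (PowerSeries.mk fun n => coeff n ((p : PowerSeries ℚ) ^ n)) := by
  set φ : PowerSeries ℚ := (p : PowerSeries ℚ) with hφ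
  have hc : constantCoeff φ = 1 := by
    rw [← coeff_zero_eq_constantCoeff_apply, hφ, Polynomial.coeff_coe, h0]
  obtain ⟨w, hw⟩ := exists_root φ
  have hT1 : lagT φ 1 = PowerSeries.mk fun n => coeff n (φ ^ n) := by
    have := lagT_map φ 1
    simpa using this
  rw [← hT1]
  set f := lagT φ 1 with hf
  have hf0 : f ≠ 0 := by
    intro h
    have := congrArg (coeff 0) (hT1.symm.trans h)
    simp at this
  have hwz : w = X * Polynomial.aeval w p := by
    have h1 := hw 1
    rw [lagT_X_mul, hφ, lagT_poly _ w hw, ← hφ, ← hf, ← mul_assoc] at h1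
    exact (mul_right_cancel₀ hf0 h1).symm
  have hw0 : constantCoeff w = 0 := by rw [hwz]; simp
  have hpw : constantCoeff (Polynomial.aeval w p) = 1 := by
    have : constantCoeff (Polynomial.aeval w p) = Polynomial.eval (constantCoeff w) p := by
      rw [Polynomial.aeval_def, Polynomial.hom_eval₂]
      rfl
    rw [this, hw0, ← Polynomial.coeff_zero_eq_eval_zero, h0]
  have key : Polynomial.aeval w p =
      Polynomial.aeval w (p - Polynomial.X * Polynomial.derivative p) * f := by
    have h1 := lagT_norm φ hc
    have h2 := lagT_poly φ w hw p
      (PowerSeries.map (C (R := ℚ)) (φ⁻¹ * (φ - X * derivative ℚ φ)))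
    have h3 := lagT_poly φ w hw (p - Polynomial.X * Polynomial.derivative p) 1
    rw [h1, mul_one, ← hφ, ← map_mul, ← mul_assoc,
      PowerSeries.mul_inv_cancel φ (by simp [hc]), one_mul] at h2
    rw [← h2, hf, ← h3, mul_one]
    congr 2
    simp only [Polynomial.coe_sub, Polynomial.coe_mul, Polynomial.coe_X, hφ]
    rw [derivative_coe]
  have hwalg : IsAlgebraic (Polynomial ℚ) w := by
    refine ⟨Polynomial.X - Polynomial.C Polynomial.X * p.map Polynomial.C, ?_, ?_⟩
    · intro h
      have := congrArg (Polynomial.map (Polynomial.evalRingHom (0 : ℚ))) h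
      simp at this
    · simp only [map_sub, map_mul, Polynomial.aeval_X, Polynomial.aeval_C]
      have e : Polynomial.aeval w (p.map (Polynomial.C : ℚ →+* _)) = Polynomial.aeval w p := by
        have := Polynomial.aeval_map_algebraMap (Polynomial ℚ) w p
        simpa using this
      have e2 : algebraMap (Polynomial ℚ) (PowerSeries ℚ) Polynomial.X = X := by
        simp [PowerSeries.algebraMap_apply']
      rw [e, e2, ← hwz, sub_self]
  have halg : ∀ q : Polynomial ℚ, IsAlgebraic (Polynomial ℚ) (Polynomial.aeval w q) := by
    intro q
    induction q using Polynomial.induction_on' with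
    | add p q hp hq => rw [map_add]; exact hp.add hq
    | monomial n a =>
      rw [Polynomial.aeval_monomial]
      refine IsAlgebraic.mul ?_ (hwalg.pow n)
      rw [IsScalarTower.algebraMap_apply ℚ (Polynomial ℚ) (PowerSeries ℚ)]
      exact isAlgebraic_algebraMap _
  refine IsAlgebraic.of_mul (y := Polynomial.aeval w (p - Polynomial.X * Polynomial.derivative p))
    (mem_nonZeroDivisors_of_ne_zero ?_) (halg _) ?_
  · intro h
    rw [h, zero_mul] at key
    rw [key] at hpw
    simp at hpw
  · rw [← key]; exact halg _

theorem coeff_id (j n : ℕ) :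
    (((1 + Polynomial.X) * (Polynomial.X + (1 + Polynomial.X) ^ j)) ^ n : Polynomial ℚ).coeff n =
      ((∑ k ∈ Finset.range (n + 1), n.choose k * ((n + j * k).choose k) : ℕ) : ℚ) := by
  rw [mul_pow, add_comm Polynomial.X ((1 + Polynomial.X) ^ j), add_pow ((1 + Polynomial.X) ^ j), Finset.mul_sum,
    Polynomial.finsetSum_coeff, Nat.cast_sum]
  refine Finset.sum_congr rfl fun k hk => ?_
  have hk' : k ≤ n := by simp at hk; omega
  have : ((1 + Polynomial.X) ^ n * (((1 + Polynomial.X) ^ j) ^ k * Polynomial.X ^ (n - k) *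
      ((n.choose k : ℕ) : Polynomial ℚ)) : Polynomial ℚ) =
      Polynomial.C ((n.choose k : ℕ) : ℚ) *
        ((1 + Polynomial.X) ^ (n + j * k) * Polynomial.X ^ (n - k)) := by
    rw [pow_add, pow_mul, Polynomial.C_eq_natCast]; ring
  rw [this, Polynomial.coeff_C_mul, Polynomial.coeff_mul_X_pow', if_pos (by omega),
    Nat.sub_sub_self hk', Polynomial.coeff_one_add_X_pow, Nat.cast_mul]

/-- For `j ≥ 1`, the series `∑_n (∑_k C(n,k) C(n+jk,k)) z^n` is algebraic. -/
theorem binomial_sum_series_algebraic (j : ℕ) (hj : 1 ≤ j) :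
    PowerSeries.IsAlgebraicSeries (PowerSeries.mk fun n =>
      ((∑ k ∈ Finset.range (n + 1), n.choose k * ((n + j * k).choose k) : ℕ) : ℚ)) := by
  obtain ⟨P, hP, h⟩ := lag_algebraic
    ((1 + Polynomial.X) * (Polynomial.X + (1 + Polynomial.X) ^ j))
    (by simp [Polynomial.coeff_zero_eq_eval_zero])
  refine ⟨P, hP, ?_⟩
  simp only [← Polynomial.coe_pow, Polynomial.coeff_coe, coeff_id] at h
  rw [Polynomial.aeval_def] at h
  have e : (Polynomial.coeToPowerSeries.ringHom : Polynomial ℚ →+* PowerSeries ℚ) =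
      algebraMap (Polynomial ℚ) (PowerSeries ℚ) := by
    refine RingHom.ext fun q => ?_
    simp [PowerSeries.algebraMap_apply']
  rw [e]
  exact h
end

section
/- Let S = {(−1,1), (0,1), (1,1), (0,−1)} ⊂ ℤ², and for n ≥ 0 let a_n be the number of sequences (s_1, …, s_n) with each s_i ∈ S such that for every j with 1 ≤ j ≤ n the partial sum s_1 + ⋯ + s_j has both coordinates nonnegative (so a_0 = 1, a_1 = 2, a_2 = 7, a_3 = 23, …). Then the generating function f = ∑_{n≥0} a_n z^n ∈ ℚ[[z]] is transcendental over ℚ(z). -/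
/-- The "trident" step set `{(−1,1), (0,1), (1,1), (0,−1)}` in `ℤ²`. -/
def tridentStepSet : Set (ℤ × ℤ) := {(-1, 1), (0, 1), (1, 1), (0, -1)}

/-- The number of trident walks of length `n` starting at the origin and
staying in the quarter plane `ℕ²`: sequences of `n` steps from the trident
step set all of whose partial sums have nonnegative coordinates. -/
noncomputable def tridentWalks (n : ℕ) : ℕ :=
  Nat.card {s : Fin n → ℤ × ℤ //
    (∀ i, s i ∈ tridentStepSet) ∧
    ∀ j : Fin n, 0 ≤ (∑ i ∈ Finset.Iic j, s i).1 ∧ 0 ≤ (∑ i ∈ Finset.Iic j, s i).2}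

/-! Part 1: combinatorics -/

namespace Trident

def tb (n u j : ℕ) : ℤ :=
  if n ≤ 2 * u + j then (n.choose u : ℤ) - (n.choose (u + j + 1) : ℤ) else 0

lemma tb_ss (n u j : ℕ) : tb (n+1) (u+1) (j+1) = tb n u (j+2) + tb n (u+1) j := by
  unfold tb
  have e : n + 1 ≤ 2 * (u+1) + (j+1) ↔ n ≤ 2 * u + (j+2) := by omega
  have e2 : n ≤ 2 * (u+1) + j ↔ n ≤ 2 * u + (j+2) := by omega
  simp only [e, e2]
  split_ifs
  · rw [Nat.choose_succ_succ n u, show u + 1 + (j+1) + 1 = (u + j + 2) + 1 by ring,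
      Nat.choose_succ_succ n (u+j+2), show u + (j+2) + 1 = u + j + 3 by ring,
      show u + 1 + j + 1 = u + j + 2 by ring]
    push_cast
    ring
  · simp

lemma tb_s0 (n u : ℕ) : tb (n+1) (u+1) 0 = tb n u 1 := by
  unfold tb
  have e : n + 1 ≤ 2 * (u+1) + 0 ↔ n ≤ 2 * u + 1 := by omega
  simp only [e]
  split_ifs
  · rw [Nat.choose_succ_succ n u, show u + 1 + 0 + 1 = (u + 1) + 1 by ring,
      Nat.choose_succ_succ n (u+1)]
    push_cast
    ring
  · simp

lemma tb_0s (n j : ℕ) : tb (n+1) 0 (j+1) = tb n 0 j := by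
  unfold tb
  by_cases h : n ≤ j
  · rw [if_pos (by omega), if_pos (by omega), Nat.choose_eq_zero_of_lt (by omega : n + 1 < 0 + (j+1) + 1),
      Nat.choose_eq_zero_of_lt (by omega : n < 0 + j + 1)]
    simp
  · rw [if_neg (by omega), if_neg (by omega)]

lemma tb_00 (n : ℕ) : tb (n+1) 0 0 = 0 := by
  unfold tb
  rw [if_neg (by omega)]

lemma tb_big (n u j : ℕ) (h : n < u) : tb n u j = 0 := by
  unfold tb
  rw [Nat.choose_eq_zero_of_lt h, Nat.choose_eq_zero_of_lt (by omega : n < u + j + 1)]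
  simp

lemma tb_zero (j : ℕ) : tb 0 0 j = 1 := by
  simp [tb]

/-- vertical walks weighted by the number of up steps -/
lemma tb_sum_s (a : ℕ → ℤ) (n j : ℕ) :
    ∑ u ∈ Finset.range (n+2), tb (n+1) u (j+1) * a u =
      ∑ u ∈ Finset.range (n+1), tb n u (j+2) * a (u+1) +
      ∑ u ∈ Finset.range (n+1), tb n u j * a u := by
  have h : ∑ u ∈ Finset.range (n+1), tb n u j * a u = ∑ u ∈ Finset.range (n+2), tb n u j * a u := by
    rw [Finset.sum_range_succ _ (n+1), tb_big n (n+1) j (by omega)]; simp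
  rw [h, Finset.sum_range_succ', Finset.sum_range_succ' (fun u => tb n u j * a u)]
  simp only [tb_ss, tb_0s, add_mul, Finset.sum_add_distrib]
  ring

lemma tb_sum_0 (a : ℕ → ℤ) (n : ℕ) :
    ∑ u ∈ Finset.range (n+2), tb (n+1) u 0 * a u =
      ∑ u ∈ Finset.range (n+1), tb n u 1 * a (u+1) := by
  rw [Finset.sum_range_succ']
  simp only [tb_s0, tb_00]
  ring

def tp (n j : ℕ) : ℤ := ∑ u ∈ Finset.range (n+1), tb n u j

lemma tp_s (n j : ℕ) : tp (n+1) (j+1) = tp n (j+2) + tp n j := by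
  simpa [tp] using tb_sum_s (fun _ => 1) n j

lemma tp_0 (n : ℕ) : tp (n+1) 0 = tp n 1 := by
  simpa [tp] using tb_sum_0 (fun _ => 1) n

lemma tp_zero (j : ℕ) : tp 0 j = 1 := by simp [tp, tb_zero]

def bt (a : ℕ → ℤ) (n : ℕ) : ℤ := ∑ k ∈ Finset.range (n+1), (n.choose k : ℤ) * a k

lemma bt_succ (a : ℕ → ℤ) (n : ℕ) : bt a (n+1) = bt a n + bt (fun k => a (k+1)) n := by
  unfold bt
  have h : ∑ u ∈ Finset.range (n+1), (n.choose u : ℤ) * a u =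
      ∑ u ∈ Finset.range (n+2), (n.choose u : ℤ) * a u := by
    rw [Finset.sum_range_succ _ (n+1)]; simp
  rw [h, Finset.sum_range_succ', Finset.sum_range_succ' (fun u => (n.choose u : ℤ) * a u)]
  simp only [Nat.choose_succ_succ, Nat.cast_add, add_mul, Finset.sum_add_distrib]
  simp
  ring

lemma bt_add (a b : ℕ → ℤ) (n : ℕ) : bt (fun k => a k + b k) n = bt a n + bt b n := by
  simp [bt, mul_add, Finset.sum_add_distrib]

def tm (u i : ℕ) : ℤ := bt (fun k => tp k i) u

lemma tm_zero (i : ℕ) : tm 0 i = 1 := by simp [tm, bt, tp_zero]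

lemma tm_s (u i : ℕ) : tm (u+1) (i+1) = tm u i + tm u (i+1) + tm u (i+2) := by
  unfold tm
  rw [bt_succ]
  simp only [tp_s, bt_add]
  ring

lemma tm_0 (u : ℕ) : tm (u+1) 0 = tm u 0 + tm u 1 := by
  unfold tm
  rw [bt_succ]
  simp only [tp_0]

lemma tc_eq (n : ℕ) : ∀ i, bt (fun k => tm k i) n = tp (2*n) (2*i+1) := by
  induction n with
  | zero => intro i; simp [bt, tm_zero, tp_zero]
  | succ n ih =>
    intro i
    rw [bt_succ, show 2 * (n+1) = 2*n+1+1 by ring]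
    cases i with
    | zero =>
      simp only [tm_0, bt_add, ih]
      rw [tp_s, tp_0, tp_s]
      simp
      ring
    | succ i =>
      simp only [tm_s, bt_add, ih]
      rw [tp_s, show 2*(i+1)+2 = (2*i+3)+1 by ring, tp_s, show 2*(i+1) = (2*i+1)+1 by ring, tp_s]
      ring_nf

lemma tp_val (n : ℕ) : tp n 0 = n.choose ((n+1)/2) := by
  unfold tp tb
  have h : ∀ k ≤ n + 1, (n+1)/2 ≤ k → ∑ u ∈ Finset.range k,
      (if n ≤ 2 * u + 0 then (n.choose u : ℤ) - (n.choose (u + 0 + 1) : ℤ) else 0)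
       = n.choose ((n+1)/2) - n.choose k := by
    intro k hk h2
    induction k with
    | zero =>
      have : (n+1)/2 = 0 := by omega
      simp [this]
    | succ k ih =>
      rw [Finset.sum_range_succ]
      by_cases h3 : (n+1)/2 ≤ k
      · rw [ih (by omega) h3, if_pos (by omega)]; simp
      · rw [if_neg (by omega), Finset.sum_eq_zero]
        · have : (n+1)/2 = k + 1 := by omega
          simp [this]
        · intro u hu
          rw [Finset.mem_range] at hu
          rw [if_neg (by omega)]
  rw [h (n+1) le_rfl (by omega)]
  simp

/-! walks -/

def stepF : Finset (ℤ × ℤ) := {(-1, 1), (0, 1), (1, 1), (0, -1)}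

def wF : (n : ℕ) → ℤ × ℤ → Finset (Fin n → ℤ × ℤ)
  | 0, _ => Finset.univ
  | n+1, x => stepF.biUnion fun st =>
      if 0 ≤ x.1 + st.1 ∧ 0 ≤ x.2 + st.2 then
        (wF n (x + st)).image (fun s => (Fin.cons st s : Fin (n+1) → ℤ × ℤ)) else ∅

lemma sum_Iic_succ {n : ℕ} (s : Fin (n+1) → ℤ × ℤ) (j : Fin n) :
    ∑ i ∈ Finset.Iic j.succ, s i = s 0 + ∑ i ∈ Finset.Iic j, s i.succ := by
  have h1 : ∀ (m : ℕ) (t : Fin m → ℤ × ℤ) (k : Fin m), ∑ i ∈ Finset.Iic k, t i =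
      ∑ i, if i ≤ k then t i else 0 := by
    intro m t k
    rw [← Finset.sum_filter]
    congr 1
    ext i; simp
  rw [h1, h1, Fin.sum_univ_succ]
  simp

lemma mem_wF (n : ℕ) : ∀ (x : ℤ × ℤ) (s : Fin n → ℤ × ℤ), s ∈ wF n x ↔
    (∀ i, s i ∈ tridentStepSet) ∧
    ∀ j : Fin n, 0 ≤ x.1 + (∑ i ∈ Finset.Iic j, s i).1 ∧ 0 ≤ x.2 + (∑ i ∈ Finset.Iic j, s i).2 := by
  induction n with
  | zero => intro x s; simp [wF, eq_iff_true_of_subsingleton]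
  | succ n ih =>
    intro x s
    have hst : ∀ t, t ∈ stepF ↔ t ∈ tridentStepSet := by
      intro t; simp [stepF, tridentStepSet]
    rw [wF, Finset.mem_biUnion]
    have h0 : ∑ i ∈ Finset.Iic (0 : Fin (n+1)), s i = s 0 := by
      have : Finset.Iic (0 : Fin (n+1)) = {0} := by ext i; simp
      rw [this]; simp
    rw [Fin.forall_fin_succ (P := fun i => s i ∈ tridentStepSet), Fin.forall_fin_succ]
    simp only [sum_Iic_succ, h0]
    constructor
    · rintro ⟨st, hs, hm⟩
      split_ifs at hm with hc
      · rw [Finset.mem_image] at hm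
        obtain ⟨s', hs', rfl⟩ := hm
        rw [ih] at hs'
        simp only [Fin.cons_zero, Fin.cons_succ]
        refine ⟨⟨(hst _).1 hs, hs'.1⟩, hc, ?_⟩
        intro j
        have := hs'.2 j
        simp only [Prod.fst_add, Prod.snd_add] at this ⊢
        constructor <;> linarith [this.1, this.2]
      · simp at hm
    · rintro ⟨⟨h1, h2⟩, h3, h4⟩
      refine ⟨s 0, (hst _).2 h1, ?_⟩
      rw [if_pos h3, Finset.mem_image]
      refine ⟨fun i => s i.succ, ?_, ?_⟩
      · rw [ih]
        refine ⟨h2, fun j => ?_⟩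
        have := h4 j
        simp only [Prod.fst_add, Prod.snd_add] at this ⊢
        constructor <;> linarith [this.1, this.2]
      · exact Fin.cons_self_tail s

lemma card_wF_succ (n : ℕ) (x : ℤ × ℤ) : (wF (n+1) x).card =
    ∑ st ∈ stepF, if 0 ≤ x.1 + st.1 ∧ 0 ≤ x.2 + st.2 then (wF n (x + st)).card else 0 := by
  rw [wF, Finset.card_biUnion]
  · refine Finset.sum_congr rfl fun st _ => ?_
    split_ifs
    · rw [Finset.card_image_of_injective]
      exact Fin.cons_right_injective (α := fun _ => ℤ × ℤ) st
    · simp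
  · intro a _ b _ hab
    rw [Function.onFun, Finset.disjoint_left]
    intro s h1 h2
    split_ifs at h1 h2
    · rw [Finset.mem_image] at h1 h2
      obtain ⟨s1, _, rfl⟩ := h1
      obtain ⟨s2, _, h⟩ := h2
      have := congrFun h 0
      simp at this
      exact hab this.symm
    all_goals simp at h1 h2

lemma card_wF (n : ℕ) : ∀ i j : ℕ, ((wF n ((i : ℤ), (j : ℤ))).card : ℤ) =
    ∑ u ∈ Finset.range (n+1), tb n u j * tm u i := by
  induction n with
  | zero => intro i j; simp [wF, tb_zero, tm_zero]
  | succ n ih =>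
    intro i j
    rw [card_wF_succ]
    have e : ∀ f : ℤ × ℤ → ℕ, ∑ st ∈ stepF, f st = f (-1,1) + f (0,1) + f (1,1) + f (0,-1) := by
      intro f
      unfold stepF
      rw [Finset.sum_insert (by decide), Finset.sum_insert (by decide),
        Finset.sum_insert (by decide), Finset.sum_singleton]
      ring
    rw [e]
    have k1 : (0:ℤ) ≤ (i:ℤ) + 0 ∧ (0:ℤ) ≤ (j:ℤ) + 1 := by constructor <;> positivity
    have k2 : (0:ℤ) ≤ (i:ℤ) + 1 ∧ (0:ℤ) ≤ (j:ℤ) + 1 := by constructor <;> positivity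
    simp only [if_pos k1, if_pos k2, Prod.mk_add_mk]
    have hB : ((wF n ((i:ℤ) + 0, (j:ℤ)+1)).card : ℤ) =
        ∑ u ∈ Finset.range (n+1), tb n u (j+1) * tm u i := by
      rw [← ih]; push_cast; simp
    have hC : ((wF n ((i:ℤ) + 1, (j:ℤ)+1)).card : ℤ) =
        ∑ u ∈ Finset.range (n+1), tb n u (j+1) * tm u (i+1) := by
      rw [← ih]; push_cast; simp
    have hABC : (((if 0 ≤ (i:ℤ) + -1 ∧ 0 ≤ (j:ℤ) + 1 then (wF n ((i:ℤ) + -1, (j:ℤ) + 1)).card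
          else 0) + (wF n ((i:ℤ) + 0, (j:ℤ)+1)).card + (wF n ((i:ℤ) + 1, (j:ℤ)+1)).card : ℕ) : ℤ) =
        ∑ u ∈ Finset.range (n+1), tb n u (j+1) * tm (u+1) i := by
      push_cast
      rw [hB, hC]
      cases i with
      | zero =>
        simp [tm_0, mul_add, Finset.sum_add_distrib]
      | succ i =>
        rw [if_pos (by constructor <;> push_cast <;> linarith)]
        have : (((i+1:ℕ):ℤ) + -1, (j:ℤ)+1) = ((i:ℤ), ((j+1 : ℕ):ℤ)) := by
          ext <;> push_cast <;> ring
        rw [this, ih]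
        simp only [tm_s, mul_add, Finset.sum_add_distrib]
    have hD : (((if 0 ≤ (i:ℤ) + 0 ∧ 0 ≤ (j:ℤ) + -1 then (wF n ((i:ℤ) + 0, (j:ℤ) + -1)).card
          else 0) : ℕ) : ℤ) = match j with
          | 0 => 0
          | j+1 => ∑ u ∈ Finset.range (n+1), tb n u j * tm u i := by
      cases j with
      | zero => simp
      | succ j =>
        rw [if_pos (by constructor <;> push_cast <;> linarith)]
        have : ((i:ℤ) + 0, ((j+1:ℕ):ℤ) + -1) = ((i:ℤ), (j:ℤ)) := by
          ext <;> push_cast <;> ring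
        rw [this, ih]
    rw [Nat.cast_add, hABC, hD]
    cases j with
    | zero => simp [tb_sum_0]
    | succ j => simp [tb_sum_s]

lemma walks_eq (n : ℕ) : (tridentWalks n : ℤ) = ∑ u ∈ Finset.range (n+1), tb n u 0 * tm u 0 := by
  rw [← card_wF n 0 0]
  congr 1
  unfold tridentWalks
  rw [← Nat.card_eq_finsetCard]
  refine Nat.card_congr (Equiv.subtypeEquivRight fun s => ?_)
  rw [mem_wF]
  simp

/-- `g_n` -/
def tg (n : ℕ) : ℤ := ∑ u ∈ Finset.range (n+1),
  if 2 * u < n then ((n.choose (u+1) : ℤ) - n.choose u) * tm u 0 else 0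

lemma bt_hockey (a : ℕ → ℤ) (n : ℕ) :
    ∑ u ∈ Finset.range (n+1), (n.choose (u+1) : ℤ) * a u = ∑ m ∈ Finset.range n, bt a m := by
  induction n with
  | zero => simp
  | succ n ih =>
    rw [Finset.sum_range_succ _ n, ← ih, Finset.sum_range_succ]
    simp only [Nat.choose_succ_succ n, Nat.cast_add, add_mul, Finset.sum_add_distrib]
    rw [bt, Nat.choose_eq_zero_of_lt (by omega : n < n + 1),
      Nat.choose_eq_zero_of_lt (by omega : n < n + 1 + 1)]
    simp
    ring

/-- `c_n = choose (2n+1) n` -/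
def tc (n : ℕ) : ℤ := tp (2*n) 1

lemma walks_sub (n : ℕ) :
    (tridentWalks n : ℤ) = tg n + tc n - ∑ m ∈ Finset.range n, tc m := by
  have h := bt_hockey (fun k => tm k 0) n
  have h2 : ∀ n, bt (fun k => tm k 0) n = tc n := fun n => by rw [tc_eq]; rfl
  simp only [h2] at h
  rw [← h, ← h2, walks_eq, tg, bt, ← Finset.sum_add_distrib, ← Finset.sum_sub_distrib]
  refine Finset.sum_congr rfl fun u _ => ?_
  unfold tb
  by_cases hu : 2 * u < n
  · rw [if_neg (by omega), if_pos hu]; ring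
  · rw [if_pos (by omega), if_neg hu]; simp; ring

lemma two_tc (n : ℕ) : 2 * tc n = (n+1).centralBinom := by
  have h : tc n = tp (2*n+1) 0 := (tp_0 (2*n)).symm
  rw [h, tp_val, Nat.centralBinom_eq_two_mul_choose, show (2*n+1+1)/2 = n+1 by omega,
    show 2*(n+1) = 2*n+1+1 by ring, Nat.choose_succ_succ (2*n+1) n,
    Nat.choose_symm_half n]
  push_cast; ring

end Trident
/-! Part 2: algebra -/

namespace Trident

open PowerSeries in
lemma central_sq : (1 - 4 * X : ℚ⟦X⟧) * (PowerSeries.mk fun n => (n.centralBinom : ℚ)) ^ 2 = 1 := by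
  set B : ℚ⟦X⟧ := PowerSeries.mk fun n => (n.centralBinom : ℚ) with hB
  have hd : (1 - 4 * X : ℚ⟦X⟧) * derivative ℚ B = 2 * B := by
    ext n
    have e : (1 - 4 * X : ℚ⟦X⟧) * derivative ℚ B
        = derivative ℚ B - C (4:ℚ) * (X * derivative ℚ B) := by
      rw [show (C (4:ℚ) : ℚ⟦X⟧) = 4 from map_ofNat C 4]; ring
    have e2 : (2 : ℚ⟦X⟧) = C (2:ℚ) := (map_ofNat C 2).symm
    rw [e, e2, map_sub, coeff_C_mul, coeff_C_mul, coeff_derivative]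
    cases n with
    | zero => simp [hB]; norm_num [Nat.centralBinom]
    | succ n =>
      rw [coeff_succ_X_mul, coeff_derivative]
      simp only [hB, coeff_mk]
      have := Nat.succ_mul_centralBinom_succ (n+1)
      have h2 : (((n+1+1 : ℕ) : ℚ)) * ((n+1+1).centralBinom : ℚ)
        = 2 * (2 * ((n+1 : ℕ):ℚ) + 1) * ((n+1).centralBinom : ℚ) := by exact_mod_cast this
      push_cast at h2 ⊢
      linear_combination h2
  apply PowerSeries.derivative.ext
  · have h4 : derivative ℚ (4 : ℚ⟦X⟧) = 0 := by
      rw [show (4 : ℚ⟦X⟧) = C (4:ℚ) from (map_ofNat C 4).symm]; exact derivative_C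
    simp only [Derivation.leibniz, pow_two, map_sub, smul_eq_mul, derivative_X, h4,
      Derivation.map_one_eq_zero]
    linear_combination (2 * B) * hd
  · simp [hB]

open PowerSeries in
lemma series_rel :
    (2 * X * (1 - X) : ℚ⟦X⟧) * (PowerSeries.mk fun n => (tg n : ℚ)) =
     (2 * X * (1 - X)) * (PowerSeries.mk fun n => (tridentWalks n : ℚ)) -
     (1 - 2 * X) * ((PowerSeries.mk fun n => (n.centralBinom : ℚ)) - 1) := by
  set G : ℚ⟦X⟧ := PowerSeries.mk fun n => (tg n : ℚ)
  set F : ℚ⟦X⟧ := PowerSeries.mk fun n => (tridentWalks n : ℚ)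
  set B : ℚ⟦X⟧ := PowerSeries.mk fun n => (n.centralBinom : ℚ)
  set c : ℚ⟦X⟧ := PowerSeries.mk fun n => (tc n : ℚ)
  set S : ℚ⟦X⟧ := PowerSeries.mk fun n => (((∑ m ∈ Finset.range n, tc m : ℤ)) : ℚ)
  have h1 : F = G + c - S := by
    ext n
    simp only [F, G, c, S, coeff_mk, map_add, map_sub]
    exact_mod_cast walks_sub n
  have h2 : S = X * (S + c) := by
    ext n
    cases n with
    | zero => simp [S]
    | succ n =>
      rw [coeff_succ_X_mul]
      simp [S, c, Finset.sum_range_succ]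
  have h3 : B - 1 = X * (C (2:ℚ) * c) := by
    ext n
    cases n with
    | zero => simp [B]
    | succ n =>
      rw [coeff_succ_X_mul, coeff_C_mul]
      have : (2 : ℚ) * (tc n : ℚ) = ((n+1).centralBinom : ℚ) := by exact_mod_cast two_tc n
      simp [B, c, this, coeff_one]
  have h4 : (C (2:ℚ) : ℚ⟦X⟧) = 2 := map_ofNat C 2
  rw [h4] at h3
  rw [h3, h1]
  linear_combination (2 * X) * h2

open PowerSeries in
lemma tg_alg (h : PowerSeries.IsAlgebraicSeries
      (PowerSeries.mk fun n => ((tridentWalks n : ℕ) : ℚ))) :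
    PowerSeries.IsAlgebraicSeries (PowerSeries.mk fun n => (tg n : ℚ)) := by
  have key : ∀ f : ℚ⟦X⟧, PowerSeries.IsAlgebraicSeries f ↔ IsAlgebraic (Polynomial ℚ) f := by
    intro f; rfl
  rw [key] at h ⊢
  have hX : IsAlgebraic (Polynomial ℚ) (X : ℚ⟦X⟧) := by
    have := isAlgebraic_algebraMap (R := Polynomial ℚ) (A := ℚ⟦X⟧) Polynomial.X
    simpa [PowerSeries.algebraMap_apply'] using this
  have h1 : IsAlgebraic (Polynomial ℚ) (1 : ℚ⟦X⟧) := isAlgebraic_one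
  have h2 : IsAlgebraic (Polynomial ℚ) (2 : ℚ⟦X⟧) := by
    rw [show (2 : ℚ⟦X⟧) = 1 + 1 by norm_num]; exact h1.add h1
  have h4 : IsAlgebraic (Polynomial ℚ) (4 : ℚ⟦X⟧) := by
    rw [show (4 : ℚ⟦X⟧) = 2 + 2 by norm_num]; exact h2.add h2
  have hB : IsAlgebraic (Polynomial ℚ) (PowerSeries.mk fun n => (n.centralBinom : ℚ)) := by
    have hh : (1 - 4 * X : ℚ⟦X⟧) ≠ 0 := by
      intro h0
      have := congrArg (constantCoeff (R := ℚ)) h0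
      simp at this
    have : IsAlgebraic (Polynomial ℚ) ((PowerSeries.mk fun n => (n.centralBinom : ℚ)) ^ 2) := by
      apply IsAlgebraic.of_mul (mem_nonZeroDivisors_of_ne_zero hh) (h1.sub (h4.mul hX))
      rw [central_sq]; exact h1
    exact IsAlgebraic.of_pow (by norm_num) this
  have h20 : (2 : ℚ⟦X⟧) ≠ 0 := by
    intro h0
    have := congrArg (constantCoeff (R := ℚ)) h0
    rw [map_ofNat] at this
    simp at this
  have hh : (2 * X * (1 - X) : ℚ⟦X⟧) ≠ 0 := by
    refine mul_ne_zero (mul_ne_zero h20 X_ne_zero) ?_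
    intro h0
    have := congrArg (constantCoeff (R := ℚ)) h0
    simp at this
  have hm : IsAlgebraic (Polynomial ℚ) (2 * X * (1 - X) : ℚ⟦X⟧) := (h2.mul hX).mul (h1.sub hX)
  apply IsAlgebraic.of_mul (mem_nonZeroDivisors_of_ne_zero hh) hm
  rw [series_rel]
  exact (hm.mul h).sub ((h1.sub (h2.mul hX)).mul (hB.sub h1))

/-- `φ` converges absolutely at `x` with value `v`. -/
def Ev (x : ℝ) (φ : PowerSeries ℚ) (v : ℝ) : Prop :=
  Summable (fun n => ‖((PowerSeries.coeff n φ : ℚ) : ℝ) * x ^ n‖) ∧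
    ∑' n, ((PowerSeries.coeff n φ : ℚ) : ℝ) * x ^ n = v

lemma Ev.add {x : ℝ} {φ ψ : PowerSeries ℚ} {v w : ℝ} (h1 : Ev x φ v) (h2 : Ev x ψ w) :
    Ev x (φ + ψ) (v + w) := by
  obtain ⟨a1, rfl⟩ := h1
  obtain ⟨a2, rfl⟩ := h2
  constructor
  · refine Summable.of_nonneg_of_le (fun _ => norm_nonneg _) (fun n => ?_) (a1.add a2)
    rw [map_add]; push_cast; rw [add_mul]; exact norm_add_le _ _
  · rw [← a1.of_norm.tsum_add a2.of_norm]
    congr 1; ext n; rw [map_add]; push_cast; ring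

lemma Ev.mul {x : ℝ} {φ ψ : PowerSeries ℚ} {v w : ℝ} (h1 : Ev x φ v) (h2 : Ev x ψ w) :
    Ev x (φ * ψ) (v * w) := by
  obtain ⟨a1, rfl⟩ := h1
  obtain ⟨a2, rfl⟩ := h2
  have e : ∀ n, ((PowerSeries.coeff n (φ * ψ) : ℚ) : ℝ) * x ^ n =
      ∑ kl ∈ Finset.HasAntidiagonal.antidiagonal n, (((PowerSeries.coeff kl.1 φ : ℚ) : ℝ) * x ^ kl.1) *
        (((PowerSeries.coeff kl.2 ψ : ℚ) : ℝ) * x ^ kl.2) := by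
    intro n
    rw [PowerSeries.coeff_mul]
    push_cast
    rw [Finset.sum_mul]
    refine Finset.sum_congr rfl fun kl hkl => ?_
    rw [← Finset.HasAntidiagonal.mem_antidiagonal.1 hkl, pow_add]
    ring
  constructor
  · refine (summable_norm_sum_mul_antidiagonal_of_summable_norm a1 a2).congr fun n => ?_
    rw [e n]
  · rw [tsum_mul_tsum_eq_tsum_sum_antidiagonal_of_summable_norm a1 a2]
    exact tsum_congr e

lemma Ev.monomial (x : ℝ) (n : ℕ) (a : ℚ) : Ev x (PowerSeries.monomial n a) (a * x ^ n) := by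
  have hz : ∀ m ∉ ({n} : Finset ℕ),
      ((PowerSeries.coeff m (PowerSeries.monomial n a) : ℚ) : ℝ) * x ^ m = 0 := by
    intro m hm
    rw [PowerSeries.coeff_monomial, if_neg (by simpa using hm)]
    simp
  constructor
  · apply summable_of_ne_finset_zero (s := {n})
    intro m hm
    rw [hz m hm]; simp
  · rw [tsum_eq_sum hz]
    simp [PowerSeries.coeff_monomial]

lemma Ev.poly (x : ℝ) (p : Polynomial ℚ) :
    Ev x (p : PowerSeries ℚ) ((p.map (algebraMap ℚ ℝ)).eval x) := by
  induction p using Polynomial.induction_on' with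
  | add p q hp hq =>
    simpa using hp.add hq
  | monomial n a =>
    simpa using Ev.monomial x n a

lemma Ev.pow {x : ℝ} {φ : PowerSeries ℚ} {v : ℝ} (h : Ev x φ v) (n : ℕ) : Ev x (φ ^ n) (v ^ n) := by
  induction n with
  | zero => simpa using Ev.monomial x 0 1
  | succ n ih => rw [pow_succ, pow_succ]; exact ih.mul h

lemma Ev.eval₂ {x : ℝ} {φ : PowerSeries ℚ} {v : ℝ} (h : Ev x φ v)
    (P : Polynomial (Polynomial ℚ)) :
    Ev x (P.eval₂ Polynomial.coeToPowerSeries.ringHom φ)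
      (((P.map (Polynomial.mapRingHom (algebraMap ℚ ℝ))).eval (Polynomial.C v)).eval x) := by
  induction P using Polynomial.induction_on' with
  | add p q hp hq =>
    simpa [Polynomial.eval₂_add] using hp.add hq
  | monomial n a =>
    simpa using (Ev.poly x a).mul (h.pow n)

lemma tg_poly (h : PowerSeries.IsAlgebraicSeries
      (PowerSeries.mk fun n => ((tridentWalks n : ℕ) : ℚ))) :
    ∃ P : Polynomial (Polynomial ℝ), P ≠ 0 ∧ ∀ x v : ℝ,
      Summable (fun n => ‖(tg n : ℝ) * x ^ n‖) → ∑' n, (tg n : ℝ) * x ^ n = v →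
      (P.eval (Polynomial.C v)).eval x = 0 := by
  obtain ⟨P, hP, h0⟩ := tg_alg h
  refine ⟨P.map (Polynomial.mapRingHom (algebraMap ℚ ℝ)), ?_, ?_⟩
  · rw [Polynomial.map_ne_zero_iff]
    · exact hP
    · exact Polynomial.map_injective _ (algebraMap ℚ ℝ).injective
  · intro x v h1 h2
    have he : Ev x (PowerSeries.mk fun n => (tg n : ℚ)) v := by
      constructor
      · simpa using h1
      · simpa using h2
    have := he.eval₂ P
    rw [h0] at this
    have h3 := this.2
    simpa using h3.symm

end Trident
/-! Part 3: analysis -/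

namespace Trident

open Filter Topology

lemma no_alg (P : Polynomial (Polynomial ℝ)) (hP : P ≠ 0) (H : ℝ → ℝ)
    (hinf : Tendsto H (𝓝[<] 1) atTop)
    (hslow : ∀ k : ℕ, Tendsto (fun x => (x - 1) * H x ^ k) (𝓝[<] 1) (𝓝 0))
    (h0 : ∀ᶠ x in 𝓝[<] (1:ℝ), (P.eval (Polynomial.C (H x))).eval x = 0) : False := by
  set π : Polynomial ℝ := Polynomial.X - Polynomial.C 1 with hπ
  have hfm : FiniteMultiplicity (Polynomial.C π) P := by
    apply FiniteMultiplicity.of_not_isUnit _ hP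
    rw [Polynomial.isUnit_C]
    exact Polynomial.not_isUnit_X_sub_C 1
  obtain ⟨Q, hQ, hnd⟩ := hfm.exists_eq_pow_mul_and_not_dvd
  have hQ0 : ∀ᶠ x in 𝓝[<] (1:ℝ), (Q.eval (Polynomial.C (H x))).eval x = 0 := by
    filter_upwards [h0, self_mem_nhdsWithin] with x hx hx1
    rw [hQ] at hx
    simp only [Polynomial.eval_mul, Polynomial.eval_pow, Polynomial.eval_C, hπ,
      Polynomial.eval_sub, Polynomial.eval_X] at hx
    have h1 : x - 1 ≠ 0 := by
      have : x < 1 := hx1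
      intro h; linarith
    exact (mul_eq_zero.1 hx).resolve_left (pow_ne_zero _ h1)
  have hex : ∃ j, (Q.coeff j).eval 1 ≠ 0 := by
    by_contra hc
    push Not at hc
    apply hnd
    rw [Polynomial.C_dvd_iff_dvd_coeff]
    intro i
    exact Polynomial.dvd_iff_isRoot.2 (hc i)
  have hmax : ∃ j, (Q.coeff j).eval 1 ≠ 0 ∧ ∀ i, j < i → (Q.coeff i).eval 1 = 0 := by
    set S := Q.support.filter (fun j => (Q.coeff j).eval 1 ≠ 0) with hS
    have hmem : ∀ i, (Q.coeff i).eval 1 ≠ 0 → i ∈ S := by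
      intro i hi
      rw [hS, Finset.mem_filter, Polynomial.mem_support_iff]
      exact ⟨fun h => hi (by rw [h]; simp), hi⟩
    obtain ⟨j0, hj0⟩ := hex
    have hne : S.Nonempty := ⟨j0, hmem j0 hj0⟩
    refine ⟨S.max' hne, ?_, ?_⟩
    · exact (Finset.mem_filter.1 (S.max'_mem hne)).2
    · intro i hi
      by_contra hc
      exact absurd (S.le_max' i (hmem i hc)) (by omega)
  obtain ⟨j, hj, hjm⟩ := hmax
  have hjd : j ∈ Finset.range (Q.natDegree + 1) := by
    rw [Finset.mem_range]
    by_contra hc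
    rw [Polynomial.coeff_eq_zero_of_natDegree_lt (by omega)] at hj
    simp at hj
  have hcont : ∀ p : Polynomial ℝ, Tendsto (fun x => p.eval x) (𝓝[<] 1) (𝓝 (p.eval 1)) := fun p =>
    (p.continuous.tendsto 1).mono_left nhdsWithin_le_nhds
  have hlim : Tendsto (fun x => ∑ i ∈ Finset.range (Q.natDegree + 1),
      (Q.coeff i).eval x * (H x ^ i / H x ^ j)) (𝓝[<] 1)
      (𝓝 (∑ i ∈ Finset.range (Q.natDegree + 1), if i = j then (Q.coeff j).eval 1 else 0)) := by
    refine tendsto_finsetSum _ fun i _ => ?_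
    rcases lt_trichotomy i j with hij | hij | hij
    · rw [if_neg (by omega)]
      have : Tendsto (fun x => (H x ^ (j - i))⁻¹) (𝓝[<] 1) (𝓝 0) :=
        tendsto_inv_atTop_zero.comp ((tendsto_pow_atTop (by omega)).comp hinf)
      have h2 := (hcont (Q.coeff i)).mul this
      rw [mul_zero] at h2
      refine h2.congr' ?_
      filter_upwards [hinf.eventually_gt_atTop 0] with x hx
      congr 1
      rw [show j = i + (j - i) by omega, pow_add, Nat.add_sub_cancel_left]
      field_simp
    · subst hij
      rw [if_pos rfl]
      have h2 := (hcont (Q.coeff i))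
      refine h2.congr' ?_
      filter_upwards [hinf.eventually_gt_atTop 0] with x hx
      field_simp
    · rw [if_neg (by omega)]
      obtain ⟨r, hr⟩ := Polynomial.dvd_iff_isRoot.2 (hjm i hij)
      have h2 := (hcont r).mul (hslow (i - j))
      rw [mul_zero] at h2
      refine h2.congr' ?_
      filter_upwards [hinf.eventually_gt_atTop 0] with x hx
      rw [hr, show i = j + (i - j) by omega, pow_add, Nat.add_sub_cancel_left]
      simp only [Polynomial.eval_mul, Polynomial.eval_sub, Polynomial.eval_X, Polynomial.eval_C]
      field_simp
  rw [Finset.sum_ite_eq' _ _ _, if_pos hjd] at hlim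
  have hz : Tendsto (fun x => ∑ i ∈ Finset.range (Q.natDegree + 1),
      (Q.coeff i).eval x * (H x ^ i / H x ^ j)) (𝓝[<] 1) (𝓝 0) := by
    refine tendsto_const_nhds.congr' ?_
    filter_upwards [hQ0] with x hx
    rw [Polynomial.eval_eq_sum_range (p := Q), Polynomial.eval_finsetSum] at hx
    simp only [Polynomial.eval_mul, Polynomial.eval_pow, Polynomial.eval_C] at hx
    simp only [← mul_div_assoc]
    rw [← Finset.sum_div, hx, zero_div]
  exact hj (tendsto_nhds_unique hlim hz)

lemma bern {t : ℝ} (ht0 : 0 < t) (ht1 : t < 1) (n : ℕ) {s : ℝ} (hs0 : 0 < s) (hs1 : s ≤ 1) :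
    1 - t ^ n ≤ (n : ℝ) ^ s * (1 - t) ^ s := by
  rw [← Real.mul_rpow (by positivity) (by linarith)]
  have h1 : 1 - t ^ n ≤ n * (1 - t) := by
    have := one_add_mul_le_pow (show (-2:ℝ) ≤ t - 1 by linarith) n
    rw [show 1 + (t - 1) = t by ring] at this
    linarith
  have h2 : 1 - t ^ n ≤ 1 := by have := pow_pos ht0 n; linarith
  rcases le_or_gt 1 ((n:ℝ) * (1 - t)) with h | h
  · exact h2.trans (Real.one_le_rpow h hs0.le)
  · rcases Nat.eq_zero_or_pos n with rfl | hn
    · simp [Real.zero_rpow hs0.ne']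
    · have hpos : 0 < (n:ℝ) * (1 - t) := by
        apply mul_pos (by exact_mod_cast hn); linarith
      refine h1.trans ?_
      calc (n:ℝ) * (1 - t) = ((n:ℝ) * (1 - t)) ^ (1:ℝ) := (Real.rpow_one _).symm
        _ ≤ _ := Real.rpow_le_rpow_of_exponent_ge hpos h.le hs1

lemma real_core (γ : ℕ → ℝ) (hγ : ∀ n, 0 ≤ γ n) (K : ℝ) (hK : ∀ n : ℕ, 1 ≤ n → γ n ≤ K / (n:ℝ)^2)
    (hns : ¬ Summable fun n : ℕ => (n:ℝ) * γ n)
    (P : Polynomial (Polynomial ℝ)) (hP : P ≠ 0)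
    (h0 : ∀ t : ℝ, 0 < t → t < 1 → (P.eval (Polynomial.C (∑' n, γ n * t ^ n))).eval t = 0) :
    False := by
  have hsum : ∀ s : ℝ, 0 < s → s < 1 → Summable fun n : ℕ => γ n * (n:ℝ) ^ s := by
    intro s hs0 hs1
    have h1 : Summable fun n : ℕ => K * (n:ℝ) ^ (s - 2) :=
      (Real.summable_nat_rpow.2 (by linarith)).mul_left K
    refine Summable.of_nonneg_of_le (fun n => mul_nonneg (hγ n) (by positivity)) (fun n => ?_) h1
    rcases Nat.eq_zero_or_pos n with rfl | hn
    · simp [Real.zero_rpow hs0.ne', Real.zero_rpow (show s - 2 ≠ 0 by linarith)]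
    · have hn' : (0:ℝ) < n := by exact_mod_cast hn
      rw [Real.rpow_sub hn', Real.rpow_two]
      calc γ n * (n:ℝ) ^ s ≤ K / (n:ℝ)^2 * (n:ℝ)^s :=
            mul_le_mul_of_nonneg_right (hK n hn) (by positivity)
        _ = _ := by ring
  have hγs : Summable γ := by
    have h1 : Summable fun n : ℕ => γ 0 * (if n = 0 then 1 else 0) + γ n * (n:ℝ) ^ (1/2 : ℝ) := by
      refine Summable.add ?_ (hsum _ (by norm_num) (by norm_num))
      refine Summable.mul_left _ ?_
      exact summable_of_ne_finset_zero (s := {0}) (fun n hn => if_neg (by simpa using hn))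
    refine Summable.of_nonneg_of_le hγ (fun n => ?_) h1
    rcases Nat.eq_zero_or_pos n with rfl | hn
    · simp
    · rw [if_neg (by omega), mul_zero, zero_add]
      apply le_mul_of_one_le_right (hγ n)
      exact Real.one_le_rpow (by exact_mod_cast hn) (by norm_num)
  have hts : ∀ t : ℝ, 0 < t → t < 1 → Summable fun n => γ n * t ^ n := by
    intro t h1 h2
    refine Summable.of_nonneg_of_le (fun n => mul_nonneg (hγ n) (by positivity)) (fun n => ?_) hγs
    exact mul_le_of_le_one_right (hγ n) (pow_le_one₀ h1.le h2.le)
  set L := ∑' n, γ n with hL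
  set H : ℝ → ℝ := fun t => (∑' n, γ n * (1 - t ^ n)) / (1 - t) with hH
  have hLs : ∀ t : ℝ, 0 < t → t < 1 → Summable fun n => γ n * (1 - t ^ n) := by
    intro t h1 h2
    simpa [mul_sub] using hγs.sub (hts t h1 h2)
  have hrel : ∀ t : ℝ, 0 < t → t < 1 → ∑' n, γ n * t ^ n = L + (t - 1) * H t := by
    intro t h1 h2
    have e : ∑' n, γ n * (1 - t ^ n) = L - ∑' n, γ n * t ^ n := by
      rw [hL, ← hγs.tsum_sub (hts t h1 h2)]
      congr 1; ext n; ring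
    simp only [hH, e]
    have : 1 - t ≠ 0 := by linarith
    field_simp
    ring
  have hev : ∀ᶠ t in 𝓝[<] (1:ℝ), 0 < t ∧ t < 1 := by
    filter_upwards [Ioo_mem_nhdsLT (show (0:ℝ) < 1 by norm_num)] with t ht using ht
  have hone : ∀ t : ℝ, 0 < t → t < 1 → ∀ n : ℕ, 0 ≤ 1 - t ^ n := by
    intro t h1 h2 n
    have := pow_le_one₀ (n := n) h1.le h2.le
    linarith
  have hHnn : ∀ t : ℝ, 0 < t → t < 1 → 0 ≤ H t := by
    intro t h1 h2
    exact div_nonneg (tsum_nonneg fun n => mul_nonneg (hγ n) (hone t h1 h2 n)) (by linarith)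
  refine no_alg (P.comp (Polynomial.C (Polynomial.C L) +
    Polynomial.C (Polynomial.X - Polynomial.C 1) * Polynomial.X)) ?_ H ?_ ?_ ?_
  · intro hc
    rcases Polynomial.comp_eq_zero_iff.1 hc with h | ⟨_, h⟩
    · exact hP h
    · have := congrArg (fun p => Polynomial.coeff p 1) h
      simp only [Polynomial.coeff_add, Polynomial.coeff_C_mul, Polynomial.coeff_X_one,
        Polynomial.coeff_C_succ, mul_one, zero_add] at this
      exact Polynomial.X_sub_C_ne_zero (1:ℝ) this
  · rw [tendsto_atTop]
    intro M
    rw [not_summable_iff_tendsto_nat_atTop_of_nonneg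
      (fun n => mul_nonneg (Nat.cast_nonneg n) (hγ n))] at hns
    obtain ⟨N, hN⟩ := (hns.eventually_gt_atTop M).exists
    have hc : Continuous fun t : ℝ => ∑ n ∈ Finset.range N, γ n * ∑ i ∈ Finset.range n, t ^ i := by
      fun_prop
    have h1 : Tendsto (fun t : ℝ => ∑ n ∈ Finset.range N, γ n * ∑ i ∈ Finset.range n, t ^ i)
        (𝓝[<] 1) (𝓝 (∑ n ∈ Finset.range N, (n:ℝ) * γ n)) := by
      have := (hc.tendsto 1).mono_left (nhdsWithin_le_nhds (s := Set.Iio 1))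
      refine this.congr' (EventuallyEq.refl _ _) |>.trans (le_of_eq ?_)
      congr 1
      refine Finset.sum_congr rfl fun n _ => ?_
      simp [mul_comm]
    filter_upwards [Filter.Tendsto.eventually_const_lt hN h1, hev] with t ht ⟨ht0, ht1⟩
    refine ht.le.trans ?_
    rw [hH]
    simp only
    rw [le_div_iff₀ (by linarith)]
    refine le_trans (le_of_eq ?_) ((hLs t ht0 ht1).sum_le_tsum (Finset.range N)
      (fun n _ => mul_nonneg (hγ n) (hone t ht0 ht1 n)))
    rw [Finset.sum_mul]
    refine Finset.sum_congr rfl fun n _ => ?_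
    have := geom_sum_mul t n
    linear_combination (-γ n) * this
  · intro k
    set ε : ℝ := 1 / (k + 2) with hε
    have hε0 : 0 < ε := by positivity
    have hε1 : ε < 1 := by
      rw [hε, div_lt_one (by positivity)]
      have : (0:ℝ) ≤ k := Nat.cast_nonneg k
      linarith
    set A := ∑' n : ℕ, γ n * (n:ℝ) ^ (1 - ε) with hA
    have hs := hsum (1 - ε) (by linarith) (by linarith)
    have hbound : ∀ t : ℝ, 0 < t → t < 1 → (1 - t) ^ ε * H t ≤ A := by
      intro t h1 h2
      have hp : 0 < 1 - t := by linarith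
      have h3 : ∑' n, γ n * (1 - t ^ n) ≤ A * (1 - t) ^ (1 - ε) := by
        rw [hA, ← tsum_mul_right]
        refine (hLs t h1 h2).tsum_le_tsum (fun n => ?_) (hs.mul_right _)
        rw [mul_assoc]
        exact mul_le_mul_of_nonneg_left (bern h1 h2 n (by linarith) (by linarith)) (hγ n)
      rw [hH]
      simp only
      rw [← mul_div_assoc, div_le_iff₀ hp]
      calc (1 - t) ^ ε * ∑' n, γ n * (1 - t ^ n)
          ≤ (1 - t) ^ ε * (A * (1 - t) ^ (1 - ε)) :=
            mul_le_mul_of_nonneg_left h3 (Real.rpow_nonneg hp.le _)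
        _ = A * ((1 - t) ^ ε * (1 - t) ^ (1 - ε)) := by ring
        _ = A * (1 - t) := by
            rw [← Real.rpow_add hp, show ε + (1 - ε) = 1 by ring, Real.rpow_one]
    have hpow : ∀ t : ℝ, 0 < t → t < 1 → |(t - 1) * H t ^ k| ≤ (1 - t) ^ ε * ((1 - t)^ε * A ^ k) := by
      intro t h1 h2
      have hp : 0 < 1 - t := by linarith
      have hd : ((1 - t) ^ ε) ^ (k + 2) = 1 - t := by
        rw [← Real.rpow_natCast, ← Real.rpow_mul hp.le, hε]
        push_cast
        rw [one_div_mul_cancel (by positivity), Real.rpow_one]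
      have hδ : 0 ≤ (1 - t) ^ ε := Real.rpow_nonneg hp.le _
      have hHt := hHnn t h1 h2
      rw [abs_mul, abs_of_nonneg (pow_nonneg hHt k), abs_sub_comm, abs_of_pos hp]
      nth_rewrite 1 [← hd]
      calc ((1 - t) ^ ε) ^ (k + 2) * H t ^ k
          = (1 - t) ^ ε * ((1 - t) ^ ε * ((1 - t) ^ ε * H t) ^ k) := by rw [mul_pow]; ring
        _ ≤ _ := by
          have := pow_le_pow_left₀ (mul_nonneg hδ hHt) (hbound t h1 h2) k
          gcongr
    refine squeeze_zero_norm' (a := fun t => (1 - t) ^ ε * ((1 - t)^ε * A ^ k)) ?_ ?_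
    · filter_upwards [hev] with t ht
      rw [Real.norm_eq_abs]
      exact hpow t ht.1 ht.2
    · have h1 : Tendsto (fun t : ℝ => (1 - t) ^ ε) (𝓝[<] 1) (𝓝 0) := by
        have hc : Continuous fun t : ℝ => (1 - t) ^ ε :=
          (continuous_const.sub continuous_id).rpow_const (fun _ => Or.inr hε0.le)
        have := (hc.tendsto 1).mono_left (nhdsWithin_le_nhds (s := Set.Iio 1))
        simpa [Real.zero_rpow hε0.ne'] using this
      simpa using h1.mul (h1.mul_const (A ^ k))
  · filter_upwards [hev] with t ht
    have := h0 t ht.1 ht.2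
    rw [hrel t ht.1 ht.2] at this
    rw [Polynomial.eval_comp]
    have hl : ∀ q : Polynomial (Polynomial ℝ), ∀ a b : Polynomial ℝ, a.eval t = b.eval t →
        (q.eval a).eval t = (q.eval b).eval t := by
      intro q a b hab
      rw [Polynomial.eval_eq_sum_range (p := q), Polynomial.eval_eq_sum_range (p := q),
        Polynomial.eval_finsetSum, Polynomial.eval_finsetSum]
      simp [hab]
    rw [← this]
    apply hl
    simp

end Trident
/-! Part 4: bounds -/

namespace Trident

lemma cb_lo (m : ℕ) : 16 ^ (m+1) ≤ (m+1).centralBinom ^ 2 * (4 * (m+1)) := by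
  induction m with
  | zero => decide
  | succ m ih =>
    have h := Nat.succ_mul_centralBinom_succ (m+1)
    have hp : 0 < (m+1)*(m+1+1) := by positivity
    refine Nat.le_of_mul_le_mul_left ?_ hp
    calc (m+1)*(m+1+1) * 16 ^ (m+1+1) = 16 ^ (m+1) * (16 * ((m+1) * (m+2))) := by ring
      _ ≤ ((m+1).centralBinom ^ 2 * (4 * (m+1))) * (4 * (2*(m+1)+1)^2) := by
          apply Nat.mul_le_mul ih
          nlinarith
      _ = 4 * (m+1) * (2 * (2 * (m+1) + 1) * (m+1).centralBinom)^2 := by ring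
      _ = 4 * (m+1) * ((m+1+1) * (m+1+1).centralBinom)^2 := by rw [h]
      _ = _ := by ring

lemma cb_hi (m : ℕ) : m.centralBinom ^ 2 * (2 * m + 1) ≤ 16 ^ m := by
  induction m with
  | zero => simp
  | succ m ih =>
    have h := Nat.succ_mul_centralBinom_succ m
    have hp : 0 < (m+1)^2 := by positivity
    refine Nat.le_of_mul_le_mul_left ?_ hp
    calc (m+1)^2 * ((m+1).centralBinom ^ 2 * (2 * (m+1) + 1))
        = ((m+1) * (m+1).centralBinom)^2 * (2*m+3) := by ring
      _ = (2 * (2 * m + 1) * m.centralBinom)^2 * (2*m+3) := by rw [h]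
      _ = (m.centralBinom ^ 2 * (2 * m + 1)) * (4 * (2*m+1) * (2*m+3)) := by ring
      _ ≤ 16 ^ m * (16 * (m+1)^2) := by
          apply Nat.mul_le_mul ih
          nlinarith
      _ = _ := by ring

def qq (k : ℕ) : ℕ := k.choose ((k+1)/2)

lemma qq_even (m : ℕ) : qq (2*m) = m.centralBinom := by
  rw [qq, show (2*m+1)/2 = m by omega]; rfl

lemma qq_odd (m : ℕ) : 2 * qq (2*m+1) = (m+1).centralBinom := by
  rw [qq, Nat.centralBinom_eq_two_mul_choose, show (2*m+1+1)/2 = m+1 by omega,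
    show 2*(m+1) = 2*m+1+1 by ring, Nat.choose_succ_succ (2*m+1) m,
    Nat.choose_symm_half m]
  ring

lemma qq_hi (k : ℕ) : qq k ^ 2 * (k + 1) ≤ 4 ^ k := by
  rcases Nat.even_or_odd' k with ⟨m, rfl | rfl⟩
  · rw [qq_even, pow_mul]; exact cb_hi m
  · have h := cb_hi (m+1)
    rw [← qq_odd] at h
    have e : (16:ℕ) ^ (m+1) = 4 * 4 ^ (2*m+1) := by
      rw [pow_succ 4 (2*m), pow_mul, pow_succ]; norm_num; ring
    rw [e] at h
    nlinarith [Nat.zero_le (qq (2*m+1) ^ 2)]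

lemma qq_lo (k : ℕ) : 4 ^ k ≤ 4 * (qq k ^ 2 * (k + 1)) := by
  rcases Nat.even_or_odd' k with ⟨m, rfl | rfl⟩
  · rw [qq_even, pow_mul]
    cases m with
    | zero => simp
    | succ m =>
      have h := cb_lo m
      norm_num at h ⊢
      nlinarith [Nat.zero_le ((m+1).centralBinom ^ 2 * m), Nat.zero_le ((m+1).centralBinom ^ 2)]
  · have h := cb_lo m
    rw [← qq_odd] at h
    have e : (16:ℕ) ^ (m+1) = 4 * 4 ^ (2*m+1) := by
      rw [pow_succ 4 (2*m), pow_mul, pow_succ]; norm_num; ring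
    rw [e] at h
    nlinarith [Nat.zero_le (qq (2*m+1) ^ 2), Nat.zero_le (qq (2*m+1) ^ 2 * m)]

def mm (u : ℕ) : ℝ := ∑ k ∈ Finset.range (u+1), (u.choose k : ℝ) * (qq k : ℝ)

lemma tm_eq (u : ℕ) : (tm u 0 : ℝ) = mm u := by
  simp [tm, bt, tp_val, mm, qq]

lemma sum_two (u : ℕ) : ∑ k ∈ Finset.range (u+1), (u.choose k : ℝ) * 2 ^ k = 3 ^ u := by
  have := add_pow (2:ℝ) 1 u
  norm_num at this
  rw [this]
  exact Finset.sum_congr rfl fun k _ => by ring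

lemma mm_nonneg (u : ℕ) : 0 ≤ mm u := Finset.sum_nonneg fun _ _ => by positivity

lemma mm_lo (u : ℕ) : (3:ℝ) ^ u ≤ 2 * Real.sqrt (u+1) * mm u := by
  rw [← sum_two, mm, Finset.mul_sum]
  refine Finset.sum_le_sum fun k hk => ?_
  rw [Finset.mem_range] at hk
  have h : (2:ℝ)^k ≤ 2 * Real.sqrt (u+1) * (qq k : ℝ) := by
    apply le_of_sq_le_sq _ (by positivity)
    rw [mul_pow, mul_pow, Real.sq_sqrt (by positivity)]
    have h1 : ((4 ^ k : ℕ) : ℝ) ≤ ((4 * (qq k ^ 2 * (k + 1)) : ℕ) : ℝ) := by exact_mod_cast qq_lo k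
    push_cast at h1
    have h2 : (k:ℝ) ≤ u := by exact_mod_cast (by omega : k ≤ u)
    calc ((2:ℝ)^k)^2 = 4 ^ k := by rw [← pow_mul, mul_comm, pow_mul]; norm_num
      _ ≤ 4 * ((qq k:ℝ) ^ 2 * (k + 1)) := h1
      _ ≤ 4 * ((qq k:ℝ) ^ 2 * (u + 1)) := by gcongr
      _ = _ := by ring
  calc (u.choose k : ℝ) * 2 ^ k ≤ (u.choose k : ℝ) * (2 * Real.sqrt (u+1) * (qq k : ℝ)) := by gcongr
    _ = _ := by ring

lemma mm_hi (u : ℕ) : mm u ^ 2 * ((u:ℝ) + 1) ≤ 2 * (9:ℝ) ^ u := by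
  have h1 : mm u ^ 2 ≤ (∑ k ∈ Finset.range (u+1), (u.choose k : ℝ) * 2 ^ k) *
      (∑ k ∈ Finset.range (u+1), (u.choose k : ℝ) * ((qq k : ℝ)^2 / 2 ^ k)) := by
    apply Finset.sum_sq_le_sum_mul_sum_of_sq_eq_mul
    · intros; positivity
    · intros; positivity
    · intro k _
      field_simp
  have h2 : (∑ k ∈ Finset.range (u+1), (u.choose k : ℝ) * ((qq k : ℝ)^2 / 2 ^ k)) * ((u:ℝ) + 1)
      ≤ 2 * (3:ℝ) ^ u := by
    have h3 : ∑ k ∈ Finset.range (u+1), ((u+1).choose (k+1) : ℝ) * 2 ^ (k+1) ≤ (3:ℝ) ^ (u+1) := by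
      rw [← sum_two (u+1), Finset.sum_range_succ' _ (u+1)]
      simp
    rw [Finset.sum_mul]
    calc _ ≤ ∑ k ∈ Finset.range (u+1), ((u+1).choose (k+1) : ℝ) * 2 ^ k := by
          refine Finset.sum_le_sum fun k _ => ?_
          have h4 : ((u:ℝ)+1) * (u.choose k : ℝ) = ((u+1).choose (k+1) : ℝ) * (k + 1) := by
            exact_mod_cast Nat.add_one_mul_choose_eq u k
          have h5 : (qq k : ℝ)^2 * (k+1) ≤ 4 ^ k := by exact_mod_cast qq_hi k
          have h6 : (qq k : ℝ)^2 / 2 ^ k * (k+1) ≤ 2 ^ k := by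
            rw [div_mul_eq_mul_div, div_le_iff₀ (by positivity), ← mul_pow]
            norm_num; exact h5
          calc _ = (((u:ℝ)+1) * (u.choose k : ℝ)) * ((qq k : ℝ)^2 / 2 ^ k) := by ring
            _ = ((u+1).choose (k+1) : ℝ) * ((qq k : ℝ)^2 / 2 ^ k * (k+1)) := by rw [h4]; ring
            _ ≤ _ := by gcongr
      _ = (∑ k ∈ Finset.range (u+1), ((u+1).choose (k+1) : ℝ) * 2 ^ (k+1)) / 2 := by
          rw [Finset.sum_div]; exact Finset.sum_congr rfl fun k _ => by ring
      _ ≤ 3 ^ (u+1) / 2 := by gcongr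
      _ ≤ 2 * 3 ^ u := by
          rw [pow_succ]; have : (0:ℝ) < 3 ^ u := by positivity
          linarith
  rw [sum_two] at h1
  calc mm u ^ 2 * ((u:ℝ) + 1) ≤ (3 ^ u * (∑ k ∈ Finset.range (u+1),
        (u.choose k : ℝ) * ((qq k : ℝ)^2 / 2 ^ k))) * (u + 1) := by gcongr
    _ = 3 ^ u * ((∑ k ∈ Finset.range (u+1),
        (u.choose k : ℝ) * ((qq k : ℝ)^2 / 2 ^ k)) * (u + 1)) := by ring
    _ ≤ 3 ^ u * (2 * 3 ^ u) := by gcongr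
    _ = 2 * 9 ^ u := by
      rw [show (9:ℝ) = 3 * 3 by norm_num, mul_pow]; ring

/-- `1/√3` -/
noncomputable def rr : ℝ := (Real.sqrt 3)⁻¹

lemma rr_pos : 0 < rr := by unfold rr; positivity

lemma rr_sq : rr ^ 2 = 1 / 3 := by
  unfold rr; rw [inv_pow, Real.sq_sqrt (by norm_num)]; norm_num

lemma rr_lt : rr < 1 := by
  have h := rr_sq
  have := rr_pos
  nlinarith

noncomputable def gam (n : ℕ) : ℝ := (tg n : ℝ) * (rr / 2) ^ n

def dd (n u : ℕ) : ℝ := (n.choose (u+1) : ℝ) - n.choose u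

lemma dd_mul (n u : ℕ) (h : 2 * u < n) :
    dd n u * ((n:ℝ) - u) = n.choose (u+1) * ((n - 2 * u - 1 : ℕ) : ℝ) := by
  have h1 : (n.choose (u+1) : ℝ) * (u + 1) = n.choose u * ((n - u : ℕ) : ℝ) := by
    exact_mod_cast Nat.choose_succ_right_eq n u
  rw [Nat.cast_sub (by omega)] at h1
  rw [Nat.sub_sub, Nat.cast_sub (by omega)]
  push_cast
  unfold dd
  linear_combination h1

lemma dd_nonneg (n u : ℕ) (h : 2 * u < n) : 0 ≤ dd n u := by
  have h1 := dd_mul n u h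
  have h2 : (0:ℝ) < (n:ℝ) - u := by
    have : (u:ℝ) < n := by exact_mod_cast (by omega : u < n)
    linarith
  by_contra hc
  push Not at hc
  have h3 : dd n u * ((n:ℝ) - u) < 0 := mul_neg_of_neg_of_pos hc h2
  rw [h1] at h3
  have : (0:ℝ) ≤ n.choose (u+1) * ((n - 2 * u - 1 : ℕ) : ℝ) := by positivity
  linarith

lemma gam_eq (n : ℕ) : gam n = ∑ u ∈ (Finset.range (n+1)).filter (fun u => 2 * u < n),
    dd n u * mm u * (rr / 2) ^ n := by
  rw [gam, tg, Finset.sum_filter]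
  push_cast
  rw [Finset.sum_mul]
  refine Finset.sum_congr rfl fun u _ => ?_
  split_ifs
  · rw [tm_eq]; rfl
  · simp

lemma gam_nonneg (n : ℕ) : 0 ≤ gam n := by
  rw [gam_eq]
  refine Finset.sum_nonneg fun u hu => ?_
  have := dd_nonneg n u (Finset.mem_filter.1 hu).2
  have := mm_nonneg u
  have := rr_pos
  positivity

noncomputable def hh (k : ℕ) : ℝ := 4 * (((k+1 : ℕ) : ℝ) ^ 2 * rr ^ (k+1))

lemma hh_summable : Summable hh := by
  unfold hh
  apply Summable.mul_left
  have := summable_pow_mul_geometric_of_norm_lt_one (R := ℝ) 2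
    (r := rr) (by rw [Real.norm_eq_abs, abs_of_pos rr_pos]; exact rr_lt)
  exact (summable_nat_add_iff 1).2 this

lemma term_hi (n u : ℕ) (h : 2 * u < n) :
    dd n u * mm u * (rr / 2) ^ n ≤ hh (n - 1 - 2 * u) / (n:ℝ)^2 := by
  obtain ⟨k, hk⟩ : ∃ k, n = 2 * u + 1 + k := ⟨n - 2*u - 1, by omega⟩
  have hn : (0:ℝ) < n := by exact_mod_cast (by omega : 0 < n)
  have hkn : (n:ℝ) = 2 * u + 1 + k := by exact_mod_cast hk
  have hu0 : (0:ℝ) ≤ u := by positivity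
  have hk0 : (0:ℝ) ≤ k := by positivity
  have hsn : 0 < Real.sqrt n := Real.sqrt_pos.2 hn
  have hss : Real.sqrt n ^ 2 = n := Real.sq_sqrt hn.le
  have hq : (n.choose (u+1) : ℝ) * Real.sqrt n ≤ 2 ^ n := by
    have h1 : n.choose (u+1) ≤ qq n := by
      have h2 : qq n = n.choose (n/2) := by
        unfold qq
        exact Nat.choose_symm_of_eq_add (by omega)
      rw [h2]; exact Nat.choose_le_middle _ _
    have h1' : (n.choose (u+1) : ℝ) ≤ qq n := by exact_mod_cast h1
    have h3 : (qq n : ℝ) * Real.sqrt n ≤ 2 ^ n := by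
      apply le_of_sq_le_sq _ (by positivity)
      rw [mul_pow, hss]
      have h5 : (qq n : ℝ)^2 * (n+1) ≤ 4 ^ n := by exact_mod_cast qq_hi n
      have h6 : ((2:ℝ)^n)^2 = 4 ^ n := by rw [← pow_mul, mul_comm, pow_mul]; norm_num
      rw [h6]
      nlinarith [sq_nonneg (qq n : ℝ)]
    exact (mul_le_mul_of_nonneg_right h1' hsn.le).trans h3
  have hd : dd n u * n ≤ 2 * k * n.choose (u+1) := by
    have h1 := dd_mul n u h
    rw [show n - 2 * u - 1 = k by omega] at h1
    have h2 := dd_nonneg n u h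
    have : dd n u * n ≤ dd n u * (2 * ((n:ℝ) - u)) :=
      mul_le_mul_of_nonneg_left (by linarith) h2
    linarith
  have hm : mm u * Real.sqrt n ≤ 2 * 3 ^ u * (k+1) := by
    apply le_of_sq_le_sq _ (by positivity)
    rw [mul_pow, hss]
    have h1 := mm_hi u
    have h2 : (n:ℝ) ≤ 2 * (u+1) * (k+1) := by nlinarith [mul_nonneg hu0 hk0]
    have h9 : ((3:ℝ)^u)^2 = 9 ^ u := by rw [← pow_mul, mul_comm, pow_mul]; norm_num
    calc mm u ^ 2 * n ≤ mm u ^ 2 * (2 * (u+1) * (k+1)) := by gcongr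
      _ = (mm u ^ 2 * (u+1)) * (2 * (k+1)) := by ring
      _ ≤ (2 * 9 ^ u) * (2 * (k+1)) := by gcongr
      _ ≤ (2 * 9 ^ u) * (2 * (k+1)^2) := by
          have : (k:ℝ) + 1 ≤ (k+1)^2 := by nlinarith
          gcongr
      _ = _ := by rw [← h9]; ring
  have hmain : dd n u * mm u * (n:ℝ)^2 ≤ 4 * (k+1)^2 * (2 ^ n * 3 ^ u) := by
    have hmm := mm_nonneg u
    calc dd n u * mm u * (n:ℝ)^2 = (dd n u * n) * (mm u * n) := by ring
      _ ≤ (2 * k * n.choose (u+1)) * (mm u * n) := by gcongr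
      _ = 2 * k * n.choose (u+1) * mm u * n := by ring
      _ = 2 * k * n.choose (u+1) * mm u * (Real.sqrt n * Real.sqrt n) := by
          rw [Real.mul_self_sqrt (Nat.cast_nonneg n)]
      _ = 2 * k * (n.choose (u+1) * Real.sqrt n) * (mm u * Real.sqrt n) := by ring
      _ ≤ 2 * k * (2 ^ n) * (2 * 3 ^ u * (k+1)) := by gcongr
      _ = 4 * (k * (k+1)) * (2 ^ n * 3 ^ u) := by ring
      _ ≤ _ := by
          have : (k:ℝ) * (k+1) ≤ (k+1)^2 := by nlinarith
          gcongr
  have hr : (2:ℝ) ^ n * 3 ^ u * (rr/2)^n = rr ^ (k+1) := by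
    have h1 : (2:ℝ)^n * (rr/2)^n = rr ^ n := by rw [← mul_pow]; congr 1; ring
    have h2 : (3:ℝ)^u * rr ^ (2*u) = 1 := by
      rw [pow_mul, ← mul_pow, rr_sq]; norm_num
    calc (2:ℝ) ^ n * 3 ^ u * (rr/2)^n = 3 ^ u * ((2:ℝ)^n * (rr/2)^n) := by ring
      _ = 3 ^ u * rr ^ (2 * u + (k+1)) := by rw [h1, hk]; ring_nf
      _ = (3 ^ u * rr ^ (2*u)) * rr ^ (k+1) := by rw [pow_add]; ring
      _ = _ := by rw [h2, one_mul]
  rw [le_div_iff₀ (by positivity), show n - 1 - 2 * u = k by omega, hh, ← hr]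
  push_cast
  have hrp : 0 ≤ (rr/2)^n := by have := rr_pos; positivity
  calc dd n u * mm u * (rr / 2) ^ n * (n:ℝ)^2 = (dd n u * mm u * (n:ℝ)^2) * (rr/2)^n := by ring
    _ ≤ (4 * (k+1)^2 * (2 ^ n * 3 ^ u)) * (rr/2)^n := by gcongr
    _ = _ := by ring

lemma gam_hi (n : ℕ) : gam n ≤ (∑' k, hh k) / (n:ℝ)^2 := by
  rw [gam_eq]
  calc _ ≤ ∑ u ∈ (Finset.range (n+1)).filter (fun u => 2 * u < n), hh (n - 1 - 2 * u) / (n:ℝ)^2 :=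
        Finset.sum_le_sum fun u hu => term_hi n u (Finset.mem_filter.1 hu).2
    _ = (∑ u ∈ (Finset.range (n+1)).filter (fun u => 2 * u < n), hh (n - 1 - 2 * u)) / (n:ℝ)^2 := by
        rw [Finset.sum_div]
    _ ≤ _ := by
        apply div_le_div_of_nonneg_right _ (by positivity)
        rw [← Finset.sum_image (g := fun u => n - 1 - 2 * u) (f := hh)]
        · refine hh_summable.sum_le_tsum _ fun k _ => ?_
          unfold hh; have := rr_pos; positivity
        · intro a ha b hb hab
          simp only [Finset.coe_filter, Finset.mem_range, Set.mem_setOf_eq] at ha hb hab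
          omega

lemma gam_lo (m : ℕ) : 1 / (12 * ((m:ℝ)+1) * (m+2)) ≤ gam (2 * (m+1)) := by
  rw [gam_eq]
  have hmem : m ∈ (Finset.range (2*(m+1)+1)).filter (fun u => 2 * u < 2*(m+1)) := by
    simp; omega
  refine le_trans ?_ (Finset.single_le_sum (f := fun u => dd (2*(m+1)) u * mm u *
    (rr/2)^(2*(m+1))) (fun u hu => ?_) hmem)
  · have h1 := dd_mul (2*(m+1)) m (by omega)
    rw [show 2*(m+1) - 2*m - 1 = 1 by omega, ← Nat.centralBinom_eq_two_mul_choose] at h1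
    push_cast at h1
    have h2 : (0:ℝ) < m + 1 := by positivity
    have hs := Real.sq_sqrt h2.le
    have hsp := Real.sqrt_pos.2 h2
    have hc : (4:ℝ)^(m+1) ≤ (m+1).centralBinom * (2 * Real.sqrt (m+1)) := by
      apply le_of_sq_le_sq _ (by positivity)
      rw [mul_pow, mul_pow, hs]
      have h3 : (16:ℝ)^(m+1) ≤ (m+1).centralBinom ^ 2 * (4 * (m+1)) := by exact_mod_cast cb_lo m
      calc ((4:ℝ)^(m+1))^2 = 16^(m+1) := by rw [← pow_mul, mul_comm, pow_mul]; norm_num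
        _ ≤ _ := h3
        _ = _ := by ring
    have hm := mm_lo m
    have hd : dd (2*(m+1)) m * (m+2) = (m+1).centralBinom := by linarith
    have hdd := dd_nonneg (2*(m+1)) m (by omega)
    have hr : (rr/2)^(2*(m+1)) * 12 ^ (m+1) = 1 := by
      rw [pow_mul, div_pow, rr_sq, ← mul_pow]; norm_num
    have hp : (4:ℝ)^(m+1) * 3 ^ m ≤
        ((m+1).centralBinom * (2 * Real.sqrt (m+1))) * (2 * Real.sqrt (m+1) * mm m) := by
      gcongr
    have hp2 : (12:ℝ)^(m+1) ≤ 12 * (m+1) * (m+2) * (dd (2*(m+1)) m * mm m) := by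
      calc (12:ℝ)^(m+1) = 3 * (4^(m+1) * 3 ^ m) := by
            rw [show (12:ℝ) = 4 * 3 by norm_num, mul_pow, pow_succ 3 m]; ring
        _ ≤ 3 * (((m+1).centralBinom * (2 * Real.sqrt (m+1))) * (2 * Real.sqrt (m+1) * mm m)) := by
            gcongr
        _ = 12 * (m+1).centralBinom * (Real.sqrt (m+1) ^ 2) * mm m := by ring
        _ = _ := by rw [hs, ← hd]; ring
    have hrp : 0 ≤ (rr/2)^(2*(m+1)) := by have := rr_pos; positivity
    rw [div_le_iff₀ (by positivity)]
    refine le_trans (le_of_eq hr.symm) ?_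
    calc (rr/2)^(2*(m+1)) * 12 ^ (m+1)
        ≤ (rr/2)^(2*(m+1)) * (12 * (m+1) * (m+2) * (dd (2*(m+1)) m * mm m)) := by gcongr
      _ = _ := by ring
  · have := dd_nonneg _ u (Finset.mem_filter.1 hu).2
    have := mm_nonneg u
    have := rr_pos
    positivity

lemma gam_ns : ¬ Summable fun n : ℕ => (n:ℝ) * gam n := by
  intro h
  have h1 : Summable fun m : ℕ => ((2*(m+1) : ℕ):ℝ) * gam (2*(m+1)) :=
    h.comp_injective (i := fun m : ℕ => 2*(m+1)) (fun a b hab => by simpa using hab)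
  have h2 : Summable fun m : ℕ => (1/6) * (1 / ((m + 2 : ℕ) : ℝ)) := by
    refine Summable.of_nonneg_of_le (fun _ => by positivity) (fun m => ?_) h1
    have := gam_lo m
    push_cast
    calc (1/6) * (1 / ((m:ℝ) + 2)) = (2 * ((m:ℝ)+1)) * (1 / (12 * ((m:ℝ)+1) * (m+2))) := by
          field_simp; norm_num
      _ ≤ _ := by gcongr
  have h3 : Summable fun m : ℕ => (1 / ((m + 2 : ℕ) : ℝ)) :=
    (summable_mul_left_iff (by norm_num)).1 h2
  exact Real.not_summable_one_div_natCast
    ((summable_nat_add_iff (f := fun m : ℕ => 1 / (m:ℝ)) 2).1 h3)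

end Trident

/-- The generating function of trident walks in the quarter plane
is transcendental. -/
theorem trident_walks_gf_transcendental :
    ¬ PowerSeries.IsAlgebraicSeries
      (PowerSeries.mk fun n => ((tridentWalks n : ℕ) : ℚ)) := by
  intro h
  obtain ⟨P, hP, hv⟩ := Trident.tg_poly h
  set ρ : ℝ := Trident.rr / 2 with hρ
  have hρ0 : 0 < ρ := by have := Trident.rr_pos; positivity
  set q : Polynomial ℝ := Polynomial.C ρ * Polynomial.X with hq
  have hinj : Function.Injective (Polynomial.compRingHom q) := by
    rw [injective_iff_map_eq_zero]
    intro a ha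
    rw [Polynomial.coe_compRingHom_apply] at ha
    rcases Polynomial.comp_eq_zero_iff.1 ha with h | ⟨_, h⟩
    · exact h
    · have := congrArg (fun p => Polynomial.coeff p 1) h
      simp [hq] at this
      exact absurd this hρ0.ne'
  refine Trident.real_core Trident.gam Trident.gam_nonneg (∑' k, Trident.hh k)
    (fun n _ => Trident.gam_hi n) Trident.gam_ns (P.map (Polynomial.compRingHom q))
    ((Polynomial.map_ne_zero_iff hinj).2 hP) ?_
  intro t ht0 ht1
  have e : ∀ n, (Trident.tg n : ℝ) * (ρ * t) ^ n = Trident.gam n * t ^ n := by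
    intro n; rw [Trident.gam, mul_pow]; ring
  have hs : Summable Trident.gam := by
    by_contra hc
    have h2 : Summable fun n : ℕ => (∑' k, Trident.hh k) * (1 / (n:ℝ)^2) :=
      (Real.summable_one_div_nat_pow.2 (by norm_num)).mul_left _
    refine hc (Summable.of_nonneg_of_le Trident.gam_nonneg (fun n => ?_) h2)
    rw [mul_one_div]; exact Trident.gam_hi n
  have h3 := hv (ρ * t) (∑' n, Trident.gam n * t ^ n) (by
    simp only [e]
    refine Summable.of_nonneg_of_le (fun n => norm_nonneg _) (fun n => ?_) hs
    have hg := Trident.gam_nonneg n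
    rw [Real.norm_eq_abs, abs_of_nonneg (by positivity)]
    exact mul_le_of_le_one_right hg (pow_le_one₀ ht0.le ht1.le)) (by simp only [e])
  set v := ∑' n, Trident.gam n * t ^ n
  have h4 : (P.map (Polynomial.compRingHom q)).eval (Polynomial.C v) =
      Polynomial.compRingHom q (P.eval (Polynomial.C v)) := by
    have := Polynomial.eval_map_apply (p := P) (f := Polynomial.compRingHom q) (Polynomial.C v)
    rw [← this]
    simp
  rw [h4, Polynomial.coe_compRingHom_apply, Polynomial.eval_comp]
  simpa [hq] using h3
end

section
/- Let a, b ∈ ℚ ∖ ℤ be rational numbers that are not integers, and assume that b − a is not a positive integer. Then the Gauss hypergeometric series f = 2F1(a,b;a+1;z) = ∑_{n≥0} ((a)_n (b)_n / ((a+1)_n · n!)) z^n ∈ ℚ[[z]] is transcendental over ℚ(z). -/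
open Polynomial in
lemma rat_ode (a b : ℂ) (ha : ∀ m : ℤ, a ≠ (m : ℂ)) (hb : ∀ m : ℤ, b ≠ (m : ℂ))
    (hba : ∀ m : ℤ, 0 < m → b - a ≠ (m : ℂ)) (n q : ℂ[X]) (hq : q ≠ 0) (hc : IsCoprime n q)
    (h : X * (1 - X) * (derivative n * q - n * derivative q) + (C a + C (b - a) * X) * n * q
      = C a * (1 - X) * q ^ 2) : False := by
  have ha0 : a ≠ 0 := by simpa using ha 0
  have hb0 : b ≠ 0 := by simpa using hb 0
  -- no roots
  have hnr : ∀ c, ¬ q.IsRoot c := by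
    intro c hqc
    obtain ⟨r, hr, hrc⟩ := exists_eq_pow_rootMultiplicity_mul_and_not_dvd q hq c
    have hk : 0 < q.rootMultiplicity c := (rootMultiplicity_pos hq).2 hqc
    obtain ⟨j, hj⟩ := Nat.exists_eq_succ_of_ne_zero hk.ne'
    rw [hj, Nat.succ_eq_add_one] at hr
    rw [dvd_iff_isRoot] at hrc
    have hnc : n.eval c ≠ 0 := by
      intro h0
      obtain ⟨u, v, huv⟩ := hc
      have := congrArg (eval c) huv
      have hqc' : q.eval c = 0 := hqc
      simp [h0, hqc'] at this
    have hrc' : r.eval c ≠ 0 := hrc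
    have hdq : derivative q = (X - C c) ^ j * (C ((j : ℂ) + 1) * r + (X - C c) * derivative r) := by
      rw [hr, derivative_mul, derivative_X_sub_C_pow]
      simp
      ring
    have hX : (X - C c : ℂ[X]) ≠ 0 := X_sub_C_ne_zero c
    have e1 : X * (1 - X) * (derivative n * (X - C c) * r - n * (C ((j : ℂ) + 1) * r + (X - C c) * derivative r)) + (C a + C (b - a) * X) * n * (X - C c) * r
      = C a * (1 - X) * (X - C c) ^ (j + 2) * r ^ 2 := by
      apply mul_left_cancel₀ (pow_ne_zero j hX)
      rw [hdq] at h
      rw [hr] at h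
      linear_combination h
    have hcc : c = 0 ∨ c = 1 := by
      have := congrArg (eval c) e1
      simp at this
      have hj1 : (j : ℂ) + 1 ≠ 0 := by exact_mod_cast Nat.succ_ne_zero j
      have : c * (1 - c) = 0 := by
        rcases this with h | h
        · simpa using h
        · rcases h with h | h | h
          · exact absurd h hnc
          · exact absurd h hj1
          · exact absurd h hrc'
      rcases mul_eq_zero.1 this with h | h
      · exact Or.inl h
      · right; linear_combination -h
    rcases hcc with rfl | rfl
    · have e2 : (1 - X) * (derivative n * X * r - n * (C ((j : ℂ) + 1) * r + X * derivative r)) + (C a + C (b - a) * X) * n * r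
        = C a * (1 - X) * X ^ (j + 1) * r ^ 2 := by
        apply mul_left_cancel₀ (X_ne_zero)
        simp only [C_0, sub_zero] at e1
        linear_combination e1
      have := congrArg (eval 0) e2
      simp at this
      have h3 : (a - (j + 1)) * (n.eval 0 * r.eval 0) = 0 := by linear_combination this
      have := (mul_eq_zero.1 h3).resolve_right (mul_ne_zero hnc hrc')
      apply ha (j + 1)
      push_cast
      linear_combination this
    · have e2 : -X * (derivative n * (X - 1) * r - n * (C ((j : ℂ) + 1) * r + (X - 1) * derivative r)) + (C a + C (b - a) * X) * n * r
        = C a * (1 - X) * (X - 1) ^ (j + 1) * r ^ 2 := by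
        apply mul_left_cancel₀ hX
        simp only [C_1] at e1 ⊢
        linear_combination e1
      have := congrArg (eval 1) e2
      simp at this
      have h3 : (b + (j + 1)) * (n.eval 1 * r.eval 1) = 0 := by linear_combination this
      have := (mul_eq_zero.1 h3).resolve_right (mul_ne_zero hnc hrc')
      apply hb (-(j + 1))
      push_cast
      linear_combination this
  have hq0 : q.degree = 0 := by
    by_contra hd
    obtain ⟨c, hc⟩ := IsAlgClosed.exists_root q hd
    exact hnr c hc
  obtain ⟨e, rfl⟩ : ∃ e, q = C e := ⟨_, eq_C_of_degree_eq_zero hq0⟩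
  have he : e ≠ 0 := by rintro rfl; simp at hq
  have h1 : X * (1 - X) * derivative n + (C a + C (b - a) * X) * n = C (a * e) * (1 - X) := by
    apply mul_left_cancel₀ (show (C e : ℂ[X]) ≠ 0 from hq)
    simp only [derivative_C] at h
    rw [C_mul]
    linear_combination h
  rcases Nat.eq_zero_or_pos n.natDegree with hd | hd
  · obtain ⟨t, rfl⟩ := natDegree_eq_zero.1 hd
    have h2 := congrArg (eval 0) h1
    have h3 := congrArg (eval 1) h1
    simp at h2 h3
    rcases h3 with h3 | h3
    · exact hb0 h3
    · subst h3; simp [ha0, he] at h2; exact he h2.symm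
  · obtain ⟨d, hd'⟩ := Nat.exists_eq_succ_of_ne_zero hd.ne'
    have h2 := congrArg (fun p => coeff p (d + 2)) h1
    have h4 : n.coeff (d + 2) = 0 := coeff_eq_zero_of_natDegree_lt (by omega)
    have h5 : n.coeff (d + 1) ≠ 0 := by
      have : n.leadingCoeff ≠ 0 := leadingCoeff_ne_zero.2 (by rintro rfl; simp at hd)
      rwa [leadingCoeff, hd'] at this
    have e3 : X * (1 - X) * derivative n + (C a + C (b - a) * X) * n = X * derivative n - X * (X * derivative n) + (C a * n + C (b-a) * (X * n)) := by ring
    have e4 : C (a * e) * (1 - X) = C (a * e) - C (a * e) * X := by ring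
    simp only [e3, e4] at h2
    simp only [coeff_add, coeff_sub, coeff_C_mul, coeff_X_mul, coeff_derivative, h4] at h2
    simp [coeff_X, coeff_C, coeff_derivative] at h2
    have h6 : (b - a - (d + 1)) * n.coeff (d + 1) = 0 := by linear_combination h2
    have := (mul_eq_zero.1 h6).resolve_right h5
    apply hba (d + 1) (by omega)
    push_cast
    linear_combination this

open Polynomial in
lemma rat_ode' (a b : ℂ) (ha : ∀ m : ℤ, a ≠ (m : ℂ)) (hb : ∀ m : ℤ, b ≠ (m : ℂ))
    (hba : ∀ m : ℤ, 0 < m → b - a ≠ (m : ℂ)) (n q : ℂ[X]) (hq : q ≠ 0)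
    (h : X * (1 - X) * (derivative n * q - n * derivative q) + (C a + C (b - a) * X) * n * q
      = C a * (1 - X) * q ^ 2) : False := by
  have hg : EuclideanDomain.gcd n q ≠ 0 := fun h0 => hq (EuclideanDomain.gcd_eq_zero_iff.1 h0).2
  obtain ⟨n', hn'⟩ := EuclideanDomain.gcd_dvd_left n q
  obtain ⟨q', hq'⟩ := EuclideanDomain.gcd_dvd_right n q
  have hcop : IsCoprime n' q' := by
    obtain ⟨u, v, huv⟩ : ∃ u v, u * n + v * q = EuclideanDomain.gcd n q :=
      ⟨EuclideanDomain.gcdA n q, EuclideanDomain.gcdB n q, by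
        rw [EuclideanDomain.gcd_eq_gcd_ab n q]; ring⟩
    refine ⟨u, v, mul_left_cancel₀ hg ?_⟩
    linear_combination huv - u * hn' - v * hq'
  generalize EuclideanDomain.gcd n q = g at *
  subst hn' hq'
  refine rat_ode a b ha hb hba n' q' (right_ne_zero_of_mul hq) hcop ?_
  apply mul_left_cancel₀ (pow_ne_zero 2 hg)
  simp only [derivative_mul] at h
  linear_combination h

open Polynomial in
lemma rat_ode_Q (a b : ℚ) (ha : ∀ m : ℤ, a ≠ (m : ℚ)) (hb : ∀ m : ℤ, b ≠ (m : ℚ))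
    (hba : ∀ m : ℤ, 0 < m → b - a ≠ (m : ℚ)) (n q : ℚ[X]) (hq : q ≠ 0)
    (h : X * (1 - X) * (derivative n * q - n * derivative q) + (C a + C (b - a) * X) * n * q
      = C a * (1 - X) * q ^ 2) : False := by
  refine rat_ode' a b (fun m => ?_) (fun m => ?_) (fun m hm => ?_)
    (n.map (algebraMap ℚ ℂ)) (q.map (algebraMap ℚ ℂ)) ?_ ?_
  · exact_mod_cast ha m
  · exact_mod_cast hb m
  · exact_mod_cast hba m hm
  · exact (Polynomial.map_ne_zero_iff (algebraMap ℚ ℂ).injective).2 hq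
  · have := congrArg (Polynomial.map (algebraMap ℚ ℂ)) h
    simpa [derivative_map] using this

open Polynomial in
lemma deriv_eval₂ (w : PowerSeries ℚ) (P : ℚ[X][X]) : ∃ Q : ℚ[X][X],
    (∀ i, Q.coeff i = derivative (P.coeff i)) ∧
    PowerSeries.derivative ℚ (eval₂ coeToPowerSeries.ringHom w P) =
      eval₂ coeToPowerSeries.ringHom w Q +
      eval₂ coeToPowerSeries.ringHom w (derivative P) * PowerSeries.derivative ℚ w := by
  induction P using Polynomial.induction_on' with
  | add p q hp hq =>
    obtain ⟨Q1, h1, e1⟩ := hp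
    obtain ⟨Q2, h2, e2⟩ := hq
    refine ⟨Q1 + Q2, fun i => by simp [h1, h2], ?_⟩
    simp only [eval₂_add, map_add, e1, e2]
    ring
  | monomial n c =>
    refine ⟨monomial n (derivative c), fun i => ?_, ?_⟩
    · simp only [coeff_monomial]; split_ifs <;> simp
    · simp only [eval₂_monomial, derivative_monomial, Derivation.leibniz, Derivation.leibniz_pow,
        coeToPowerSeries.ringHom_apply, PowerSeries.derivative_coe, smul_eq_mul, nsmul_eq_mul,
        coe_mul]
      have : ((n : ℚ[X]) : PowerSeries ℚ) = (n : PowerSeries ℚ) := by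
        exact map_natCast (coeToPowerSeries.ringHom (R := ℚ)) n
      rw [this]
      ring

open Polynomial in
lemma main_trace (a b : ℚ) (ha : ∀ m : ℤ, a ≠ (m : ℚ)) (hb : ∀ m : ℤ, b ≠ (m : ℚ))
    (hba : ∀ m : ℤ, 0 < m → b - a ≠ (m : ℚ)) (w : PowerSeries ℚ)
    (hw : PowerSeries.X * (1 - PowerSeries.X) * PowerSeries.derivative ℚ w
      + (PowerSeries.C a + PowerSeries.C (b - a) * PowerSeries.X) * w
      = PowerSeries.C a * (1 - PowerSeries.X))
    (halg : ∃ P : ℚ[X][X], P ≠ 0 ∧ eval₂ coeToPowerSeries.ringHom w P = 0) : False := by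
  classical
  have hex : ∃ m, ∃ P : ℚ[X][X], P ≠ 0 ∧ eval₂ coeToPowerSeries.ringHom w P = 0 ∧ P.natDegree = m := by
    obtain ⟨P, h1, h2⟩ := halg
    exact ⟨_, P, h1, h2, rfl⟩
  obtain ⟨P, hP0, hPw, hPm⟩ := Nat.find_spec hex
  have hmin : ∀ R : ℚ[X][X], eval₂ coeToPowerSeries.ringHom w R = 0 →
      R.natDegree < P.natDegree → R = 0 := by
    intro R hR hlt
    by_contra hR0
    exact Nat.find_min hex (hPm ▸ hlt) ⟨R, hR0, hR, rfl⟩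
  clear hPm hex
  obtain ⟨Q, hQ, hd⟩ := deriv_eval₂ w P
  have hm : P.natDegree ≠ 0 := by
    intro h0
    obtain ⟨c, rfl⟩ := natDegree_eq_zero.1 h0
    simp at hPw
    apply hP0
    simp [hPw]
  obtain ⟨k, hk⟩ := Nat.exists_eq_succ_of_ne_zero hm
  rw [Nat.succ_eq_add_one] at hk
  set A : ℚ[X] := C a + C (b - a) * X with hA
  set B : ℚ[X] := C a * (1 - X) with hB
  set E : ℚ[X] := X * (1 - X) with hE
  let T : ℚ[X][X] := C E * Q - C A * (derivative P * X) + C B * derivative P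
  have hT : eval₂ coeToPowerSeries.ringHom w T = 0 := by
    rw [hPw, map_zero] at hd
    simp only [T, eval₂_add, eval₂_sub, eval₂_mul, eval₂_C, eval₂_X,
      coeToPowerSeries.ringHom_apply, hA, hB, hE]
    simp only [coe_add, coe_mul, coe_sub, coe_C, coe_X, coe_one]
    linear_combination (- PowerSeries.X * (1 - PowerSeries.X)) * hd -
      eval₂ coeToPowerSeries.ringHom w (derivative P) * hw
  have cT : ∀ i, T.coeff (i + 1) = E * derivative (P.coeff (i + 1)) - A * (P.coeff (i + 1) * (i + 1))
      + B * (P.coeff (i + 2) * (i + 2)) := by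
    intro i
    simp only [T, coeff_add, coeff_sub, coeff_C_mul, coeff_mul_X, coeff_derivative, hQ]
    push_cast
    ring
  have cT0 : T.coeff 0 = E * derivative (P.coeff 0) + B * P.coeff 1 := by
    simp [T, coeff_derivative, hQ]
  have hhi : ∀ i, k + 1 < i → P.coeff i = 0 := fun i hi =>
    coeff_eq_zero_of_natDegree_lt (by omega)
  have hR := hmin (C (P.coeff (k+1)) * T - C (T.coeff (k + 1)) * P)
    (by simp [eval₂_sub, eval₂_mul, hT, hPw]) (by
      rw [hk, Nat.lt_succ_iff, natDegree_le_iff_coeff_eq_zero]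
      intro i hi
      obtain ⟨j, rfl⟩ : ∃ j, i = j + 1 := ⟨i - 1, by omega⟩
      simp only [coeff_sub, coeff_C_mul]
      rcases Nat.lt_or_ge k j with h | h
      · rw [cT j, hhi (j+1) (by omega), hhi (j+2) (by omega)]; simp
      · obtain rfl : j = k := by omega
        ring)
  have hRk := congrArg (fun p => coeff p k) hR
  have hlead : P.coeff (k + 1) ≠ 0 := by
    have : P.leadingCoeff ≠ 0 := leadingCoeff_ne_zero.2 hP0
    rwa [leadingCoeff, hk] at this
  have cTk : T.coeff k = E * derivative (P.coeff k) - A * (P.coeff k * k)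
      + B * (P.coeff (k + 1) * (k + 1)) := by
    cases k with
    | zero => rw [cT0]; simp
    | succ k => rw [cT k]; push_cast; ring
  simp only [coeff_sub, coeff_C_mul, coeff_zero] at hRk
  rw [cTk, cT k, hhi (k + 2) (by omega)] at hRk
  have hk1 : (C ((k : ℚ) + 1) : ℚ[X]) = (k : ℚ[X]) + 1 := by simp
  have hk2 : (C ((k : ℚ) + 1) : ℚ[X]) ≠ 0 := by
    rw [Ne, C_eq_zero]; positivity
  refine rat_ode_Q a b ha hb hba (- P.coeff k) (C ((k : ℚ) + 1) * P.coeff (k + 1))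
    (mul_ne_zero hk2 hlead) ?_
  rw [derivative_mul, derivative_C, derivative_neg, ← hA, ← hB, ← hE, hk1]
  linear_combination (-((k : ℚ[X]) + 1)) * hRk

/-- The series `(1 - z)^(-c)`. -/
noncomputable def binSer (c : ℚ) : PowerSeries ℚ :=
  PowerSeries.mk fun n => (ascPochhammer ℚ n).eval c / (n.factorial : ℚ)

lemma binSer_ode (c : ℚ) : (1 - PowerSeries.X) * PowerSeries.derivative ℚ (binSer c)
    = PowerSeries.C c * binSer c := by
  ext n
  rw [sub_mul, one_mul, map_sub, PowerSeries.coeff_C_mul]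
  have key : ∀ n : ℕ, (PowerSeries.coeff n) (PowerSeries.derivative ℚ (binSer c)) =
      (c + n) * ((ascPochhammer ℚ n).eval c / (n.factorial : ℚ)) := by
    intro n
    rw [PowerSeries.coeff_derivative, binSer, PowerSeries.coeff_mk, ascPochhammer_succ_eval,
      Nat.factorial_succ]
    have := Nat.factorial_ne_zero n
    push_cast
    field_simp
  rw [key]
  cases n with
  | zero => simp [binSer]
  | succ n =>
    rw [PowerSeries.coeff_succ_X_mul, key, binSer, PowerSeries.coeff_mk, ascPochhammer_succ_eval,
      Nat.factorial_succ]
    have := Nat.factorial_ne_zero n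
    push_cast
    field_simp
    ring

lemma binSer_cc (c : ℚ) : PowerSeries.constantCoeff (binSer c) = 1 := by
  simp [binSer, ← PowerSeries.coeff_zero_eq_constantCoeff_apply]

lemma ode_mul (c : ℚ) (p q : PowerSeries ℚ)
    (hp : (1 - PowerSeries.X) * PowerSeries.derivative ℚ p = PowerSeries.C c * p)
    (hq : (1 - PowerSeries.X) * PowerSeries.derivative ℚ q = PowerSeries.C (-c) * q)
    (hp0 : PowerSeries.constantCoeff p = 1) (hq0 : PowerSeries.constantCoeff q = 1) :
    p * q = 1 := by
  have hX : (1 - PowerSeries.X : PowerSeries ℚ) ≠ 0 := by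
    intro h
    have := congrArg PowerSeries.constantCoeff h
    simp at this
  apply PowerSeries.derivative.ext
  · apply mul_left_cancel₀ hX
    rw [Derivation.leibniz, PowerSeries.derivative_one]
    simp only [smul_eq_mul]
    rw [map_neg] at hq
    linear_combination q * hp + p * hq
  · simp [hp0, hq0]

lemma ode_pow (c : ℚ) (p : PowerSeries ℚ)
    (hp : (1 - PowerSeries.X) * PowerSeries.derivative ℚ p = PowerSeries.C c * p) (s : ℕ) :
    (1 - PowerSeries.X) * PowerSeries.derivative ℚ (p ^ s) = PowerSeries.C (s * c) * p ^ s := by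
  induction s with
  | zero => simp
  | succ s ih =>
    rw [pow_succ, Derivation.leibniz]
    simp only [smul_eq_mul]
    push_cast
    rw [add_mul, map_add, one_mul]
    linear_combination p * ih + p ^ s * hp

lemma one_sub_ode : (1 - PowerSeries.X) * PowerSeries.derivative ℚ (1 - PowerSeries.X)
    = PowerSeries.C (-1) * (1 - PowerSeries.X) := by
  simp

lemma algMap_eq : algebraMap (Polynomial ℚ) (PowerSeries ℚ) =
    Polynomial.coeToPowerSeries.ringHom := by
  ext <;> simp [PowerSeries.algebraMap_apply']

lemma alg_iff (f : PowerSeries ℚ) :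
    PowerSeries.IsAlgebraicSeries f ↔ IsAlgebraic (Polynomial ℚ) f := by
  simp only [PowerSeries.IsAlgebraicSeries, IsAlgebraic, Polynomial.aeval_def, algMap_eq]

lemma binSer_alg (c : ℚ) : IsAlgebraic (Polynomial ℚ) (binSer c) := by
  apply IsAlgebraic.of_pow c.den_pos
  have hcd : (c.den : ℚ) * c = c.num := by rw [mul_comm]; exact c.mul_den_eq_num
  have h1 : ∀ r : ℕ, PowerSeries.constantCoeff ((1 - PowerSeries.X : PowerSeries ℚ) ^ r) = 1 := by
    intro r; simp
  have hmap : ∀ r : ℕ, algebraMap (Polynomial ℚ) (PowerSeries ℚ) ((1 - Polynomial.X) ^ r)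
      = (1 - PowerSeries.X) ^ r := by
    intro r; rw [algMap_eq]; simp
  have halg : ∀ r : ℕ, IsAlgebraic (Polynomial ℚ) ((1 - PowerSeries.X : PowerSeries ℚ) ^ r) := by
    intro r; rw [← hmap]; exact isAlgebraic_algebraMap _
  rcases Int.eq_nat_or_neg c.num with ⟨r, hr | hr⟩
  · -- binSer c ^ s * (1-X)^r = 1
    have := ode_mul (c.den * c) (binSer c ^ c.den) ((1 - PowerSeries.X) ^ r)
      (ode_pow _ _ (binSer_ode c) _) (by
        rw [ode_pow _ _ one_sub_ode, hcd, hr]; simp) (by simp [binSer_cc]) (h1 r)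
    refine ⟨Polynomial.C ((1 - Polynomial.X) ^ r) * Polynomial.X - 1, ?_, ?_⟩
    · intro h0
      have := congrArg (fun p => Polynomial.coeff p 0) h0
      simp at this
    · simp only [map_sub, map_mul, Polynomial.aeval_C, Polynomial.aeval_X, hmap, map_one]
      rw [mul_comm, this, sub_self]
  · have e1 := ode_mul (c.den * c) (binSer c ^ c.den) (binSer (-c) ^ c.den)
      (ode_pow _ _ (binSer_ode c) _) (by
        rw [ode_pow _ _ (binSer_ode (-c)), mul_neg]) (by simp [binSer_cc]) (by simp [binSer_cc])
    have e2 := ode_mul (c.den * -c) (binSer (-c) ^ c.den) ((1 - PowerSeries.X) ^ r)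
      (ode_pow _ _ (binSer_ode (-c)) _) (by
        rw [ode_pow _ _ one_sub_ode, mul_neg (c.den : ℚ) c, hcd, hr]; simp) (by simp [binSer_cc]) (h1 r)
    have : binSer c ^ c.den = (1 - PowerSeries.X) ^ r := by
      linear_combination (1 - PowerSeries.X) ^ r * e1 - binSer c ^ c.den * e2
    rw [this]
    exact halg r

lemma poch_ratio (a : ℚ) (n : ℕ) :
    (ascPochhammer ℚ n).eval a * (a + n) = a * (ascPochhammer ℚ n).eval (a + 1) := by
  induction n with
  | zero => simp
  | succ n ih =>
    rw [ascPochhammer_succ_eval, ascPochhammer_succ_eval]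
    push_cast
    linear_combination (a + 1 + n) * ih

lemma poch_ne (a : ℚ) (ha : ∀ m : ℤ, a ≠ (m : ℚ)) (n : ℕ) :
    (ascPochhammer ℚ n).eval (a + 1) ≠ 0 := by
  induction n with
  | zero => simp
  | succ n ih =>
    rw [ascPochhammer_succ_eval]
    refine mul_ne_zero ih fun h => ha (-(n + 1)) ?_
    push_cast
    linear_combination h

/-- For `a, b ∈ ℚ ∖ ℤ` with `b − a` not a positive integer, the
hypergeometric series `₂F₁(a,b;a+1;z)` is transcendental. -/
theorem hypergeometric_2F1_a_b_a1_transcendental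
    (a b : ℚ) (ha : ∀ m : ℤ, a ≠ (m : ℚ)) (hb : ∀ m : ℤ, b ≠ (m : ℚ))
    (hba : ∀ m : ℤ, 0 < m → b - a ≠ (m : ℚ)) :
    ¬ PowerSeries.IsAlgebraicSeries (PowerSeries.mk fun n =>
      ((ascPochhammer ℚ n).eval a * (ascPochhammer ℚ n).eval b) /
        ((ascPochhammer ℚ n).eval (a + 1) * (n.factorial : ℚ))) := by
  intro h
  set f : PowerSeries ℚ := PowerSeries.mk fun n =>
      ((ascPochhammer ℚ n).eval a * (ascPochhammer ℚ n).eval b) /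
        ((ascPochhammer ℚ n).eval (a + 1) * (n.factorial : ℚ)) with hf
  have hode : PowerSeries.X * PowerSeries.derivative ℚ f + PowerSeries.C a * f
      = PowerSeries.C a * binSer b := by
    have key : ∀ n : ℕ, (a + n) * PowerSeries.coeff n f = a * PowerSeries.coeff n (binSer b) := by
      intro n
      rw [hf, binSer, PowerSeries.coeff_mk, PowerSeries.coeff_mk]
      have h1 := poch_ratio a n
      have h2 := poch_ne a ha n
      have h3 : (n.factorial : ℚ) ≠ 0 := by exact_mod_cast Nat.factorial_ne_zero n
      field_simp
      linear_combination (Polynomial.eval b (ascPochhammer ℚ n)) * h1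
    ext n
    rw [map_add, PowerSeries.coeff_C_mul, PowerSeries.coeff_C_mul, ← key]
    cases n with
    | zero => simp
    | succ n =>
      rw [PowerSeries.coeff_succ_X_mul, PowerSeries.coeff_derivative]
      push_cast
      ring
  have hinv := ode_mul b (binSer b) (binSer (-b)) (binSer_ode b) (binSer_ode (-b))
    (binSer_cc b) (binSer_cc (-b))
  refine main_trace a b ha hb hba (f * binSer (-b)) ?_
    ((alg_iff _).2 (((alg_iff f).1 h).mul (binSer_alg (-b))))
  rw [Derivation.leibniz]
  simp only [smul_eq_mul]
  have h4 := binSer_ode (-b)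
  rw [map_neg] at h4
  rw [map_sub]
  linear_combination (1 - PowerSeries.X) * binSer (-b) * hode + PowerSeries.X * f * h4
    + PowerSeries.C a * (1 - PowerSeries.X) * hinv
end

section
/- The power series f = ∑_{n≥1} z^n / n ∈ ℚ[[z]] (i.e., f = −log(1−z)) is transcendental over ℚ(z); that is, there is no nonzero polynomial P ∈ ℚ[z][Y] with P(f) = 0 in ℚ[[z]]. -/
open Polynomial in
lemma nl_deg (p : ℚ[X]) : ((1 - X) * derivative p).degree ≤ p.degree := by
  by_cases h : derivative p = 0
  · simp [h]
  have hp : p ≠ 0 := by rintro rfl; simp at h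
  have h1 : (derivative p).degree < p.degree := degree_derivative_lt hp
  have hw : (1 - X : ℚ[X]).natDegree ≤ 1 := by compute_degree
  rw [degree_eq_natDegree h, degree_eq_natDegree hp] at h1
  have h2 : (derivative p).natDegree < p.natDegree := by exact_mod_cast h1
  rw [degree_eq_natDegree hp]
  apply degree_le_of_natDegree_le
  refine natDegree_mul_le.trans ?_
  omega

open Polynomial in
lemma nl_key (a b : ℚ[X]) (d : ℚ) (hd : d ≠ 0) (ha : a ≠ 0)
    (h : a * ((1 - X) * derivative b + C d * a) - (1 - X) * derivative a * b = 0) : False := by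
  obtain ⟨q, r, hb, hr⟩ : ∃ q r : ℚ[X], b = a * q + r ∧ r.degree < a.degree :=
    ⟨b / a, b % a, (EuclideanDomain.div_add_mod b a).symm, EuclideanDomain.mod_lt b ha⟩
  have h1 : a * ((1 - X) * derivative r) - ((1 - X) * derivative a) * r
      = - (C d + (1 - X) * derivative q) * (a * a) := by
    rw [hb] at h
    simp only [derivative_add, derivative_mul] at h
    linear_combination h
  have hq : - (C d + (1 - X) * derivative q) ≠ 0 := by
    intro h0
    have := congrArg (eval 1) h0
    simp at this
    exact hd this
  have ha' : a.degree ≠ ⊥ := by simpa using ha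
  have h2 : (a * ((1 - X) * derivative r) - ((1 - X) * derivative a) * r).degree
      < a.degree + a.degree := by
    refine lt_of_le_of_lt (b := a.degree + r.degree) ?_ ?_
    · refine (degree_sub_le _ _).trans (max_le ?_ ?_)
      · rw [degree_mul]; gcongr; exact nl_deg r
      · rw [degree_mul]; gcongr; exact nl_deg a
    · exact WithBot.add_lt_add_left ha' hr
  rw [h1, degree_mul, degree_mul] at h2
  have h3 : 0 ≤ (- (C d + (1 - X) * derivative q)).degree := zero_le_degree_iff.mpr hq
  have h4 : a.degree + a.degree ≤
    (- (C d + (1 - X) * derivative q)).degree + (a.degree + a.degree) := le_add_of_nonneg_left h3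
  exact absurd h2 (not_lt.mpr h4)

/-- the coefficientwise derivation -/
noncomputable def nlD (P : Polynomial (Polynomial ℚ)) : Polynomial (Polynomial ℚ) :=
  P.sum fun n a => Polynomial.monomial n (Polynomial.derivative a)

lemma nlD_coeff (P : Polynomial (Polynomial ℚ)) (n : ℕ) :
    (nlD P).coeff n = Polynomial.derivative (P.coeff n) := by
  simp only [nlD, Polynomial.sum_def, Polynomial.finsetSum_coeff, Polynomial.coeff_monomial]
  simp only [Finset.sum_ite_eq', Polynomial.mem_support_iff]
  split_ifs with h
  · rfl
  · simp at h; simp [h]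

lemma nlD_add (P Q : Polynomial (Polynomial ℚ)) : nlD (P + Q) = nlD P + nlD Q := by
  ext1 n; simp [nlD_coeff]

lemma nlD_monomial (n : ℕ) (a : Polynomial ℚ) :
    nlD (Polynomial.monomial n a) = Polynomial.monomial n (Polynomial.derivative a) := by
  ext1 m; simp only [nlD_coeff, Polynomial.coeff_monomial]; split_ifs <;> simp

lemma nl_eval (f : PowerSeries ℚ) (P : Polynomial (Polynomial ℚ)) :
    PowerSeries.derivative ℚ (Polynomial.eval₂ Polynomial.coeToPowerSeries.ringHom f P) =
      Polynomial.eval₂ Polynomial.coeToPowerSeries.ringHom f (nlD P) +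
      Polynomial.eval₂ Polynomial.coeToPowerSeries.ringHom f (Polynomial.derivative P) *
        PowerSeries.derivative ℚ f := by
  induction P using Polynomial.induction_on' with
  | add p q hp hq =>
    simp only [Polynomial.eval₂_add, nlD_add, map_add, hp, hq]; ring
  | monomial n a =>
    rw [nlD_monomial, Polynomial.derivative_monomial]
    simp only [Polynomial.eval₂_monomial, Derivation.leibniz, PowerSeries.derivative_pow, 
      Polynomial.coeToPowerSeries.ringHom_apply, PowerSeries.derivative_coe, smul_eq_mul,
      map_mul, map_natCast]
    ring

lemma nl_deriv : (1 - PowerSeries.X) * PowerSeries.derivative ℚ (PowerSeries.mk fun n =>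
      if n = 0 then 0 else 1 / (n : ℚ)) = 1 := by
  have : PowerSeries.derivative ℚ (PowerSeries.mk fun n =>
      if n = 0 then 0 else 1 / (n : ℚ)) = PowerSeries.mk 1 := by
    ext n
    rw [PowerSeries.coeff_derivative]
    have : (n : ℚ) + 1 ≠ 0 := by positivity
    simp [this]
  rw [this, mul_comm]
  exact PowerSeries.mk_one_mul_one_sub_eq_one ℚ

open Polynomial in
lemma nl_main (f : PowerSeries ℚ) (hf : (1 - PowerSeries.X) * PowerSeries.derivative ℚ f = 1)
    (n : ℕ) : ∀ P : ℚ[X][X], P.natDegree ≤ n →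
      eval₂ coeToPowerSeries.ringHom f P = 0 → P = 0 := by
  induction n with
  | zero =>
    intro P hP h
    rw [natDegree_eq_zero.mp (Nat.le_zero.mp hP) |>.choose_spec.symm] at h ⊢
    rw [eval₂_C, coeToPowerSeries.ringHom_apply, Polynomial.coe_eq_zero_iff] at h
    simp [h]
  | succ n ih =>
    intro P hP h
    by_cases ha : P.coeff (n + 1) = 0
    · refine ih P ?_ h
      rw [natDegree_le_iff_coeff_eq_zero] at hP ⊢
      intro N hN
      rcases eq_or_lt_of_le (Nat.succ_le_of_lt hN) with h1 | h1
      · rw [← h1]; exact ha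
      · exact hP N h1
    exfalso
    set a := P.coeff (n + 1) with haa
    have hc : ∀ m, n + 1 < m → P.coeff m = 0 := fun m => natDegree_le_iff_coeff_eq_zero.mp hP m
    have hQ := ih (C a * (C (1 - X) * nlD P + derivative P) - C ((1 - X) * derivative a) * P) ?_ ?_
    · have := congrArg (fun Q => coeff Q n) hQ
      simp only [coeff_sub, coeff_C_mul, coeff_add, nlD_coeff, coeff_derivative, coeff_zero] at this
      refine nl_key a (P.coeff n) (n + 1) (by positivity) ha ?_
      rw [← haa] at this
      have hC : (C ((n : ℚ) + 1) : ℚ[X]) = (n : ℚ[X]) + 1 := by simp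
      rw [hC]
      linear_combination this
    · rw [natDegree_le_iff_coeff_eq_zero]
      intro N hN
      simp only [coeff_sub, coeff_C_mul, coeff_add, nlD_coeff, coeff_derivative]
      rw [hc (N + 1) (by omega)]
      rcases eq_or_lt_of_le (Nat.succ_le_of_lt hN) with h1 | h1
      · rw [← h1, Nat.succ_eq_add_one, ← haa]; ring
      · rw [hc N h1]; simp
    · have hd := nl_eval f P
      rw [h, map_zero] at hd
      have hw : ((1 - X : ℚ[X]) : PowerSeries ℚ) = 1 - PowerSeries.X := by simp
      simp only [eval₂_sub, eval₂_mul, eval₂_add, eval₂_C, h, coeToPowerSeries.ringHom_apply]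
      rw [hw]
      linear_combination (-(a : PowerSeries ℚ) * (1 - PowerSeries.X)) * hd
        - (a : PowerSeries ℚ) * eval₂ coeToPowerSeries.ringHom f (derivative P) * hf

/-- The power series `∑_{n≥1} z^n/n = −log(1−z)` is transcendental. -/
theorem neg_log_one_sub_transcendental :
    ¬ PowerSeries.IsAlgebraicSeries (PowerSeries.mk fun n =>
      if n = 0 then 0 else 1 / (n : ℚ)) := by
  rintro ⟨P, hP, h⟩
  exact hP (nl_main _ nl_deriv _ P le_rfl h)
end
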